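/- arXiv:1406.0438 — 12 statements merged into one kernel-verified Lean document; each statement's English description precedes it below -/
import Mathlib

section
/- Let (T, θ) be a solution of the system dT/dτ = 3T(1−T)²sin²θ, dθ/dτ = −T − (3/2)(1−T)sin(2θ) on an open interval, and suppose sin θ(τ₀) = 0 at some time τ₀. Then the first and second derivatives of T with respect to τ vanish at τ₀, while the third derivative satisfies (d³T/dτ³)(τ₀) = 6·T(τ₀)³·(1−T(τ₀))². -/
open Real Set

/-- Along a solution of dT/dτ = 3T(1−T)²sin²θ, dθ/dτ = −T − (3/2)(1−T)sin 2θ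
on an open interval, at a time τ₀ with sin θ(τ₀) = 0 one has T' (τ₀) = T''(τ₀) = 0 and
T'''(τ₀) = 6 T(τ₀)³ (1 − T(τ₀))². -/
theorem stmt_1 (a b : ℝ) (T θ : ℝ → ℝ) (τ₀ : ℝ) (hτ₀ : τ₀ ∈ Set.Ioo a b)
    (hT : ∀ τ ∈ Set.Ioo a b,
      HasDerivAt T (3 * T τ * (1 - T τ)^2 * (Real.sin (θ τ))^2) τ)
    (hθ : ∀ τ ∈ Set.Ioo a b,
      HasDerivAt θ (-(T τ) - (3/2) * (1 - T τ) * Real.sin (2 * θ τ)) τ)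
    (hsin : Real.sin (θ τ₀) = 0) :
    deriv T τ₀ = 0 ∧ deriv (deriv T) τ₀ = 0 ∧
      deriv (deriv (deriv T)) τ₀ = 6 * (T τ₀)^3 * (1 - T τ₀)^2 := by
  have hs : ∀ τ ∈ Set.Ioo a b, HasDerivAt (fun t => Real.sin (θ t))
      (Real.cos (θ τ) * (-(T τ) - (3/2) * (1 - T τ) * Real.sin (2 * θ τ))) τ :=
    fun τ hτ => (hθ τ hτ).sin
  have hT₁ : ∀ τ ∈ Set.Ioo a b,
      deriv T τ = 3 * T τ * (1 - T τ)^2 * (Real.sin (θ τ))^2 :=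
    fun τ hτ => (hT τ hτ).deriv
  have hT₂ : ∀ τ ∈ Set.Ioo a b, deriv (deriv T) τ = Real.sin (θ τ) *
      ((3 * (1 - T τ)^2 - 6 * T τ * (1 - T τ)) * (3 * T τ * (1 - T τ)^2 * (Real.sin (θ τ))^2) *
          Real.sin (θ τ) +
        6 * T τ * (1 - T τ)^2 *
          (Real.cos (θ τ) * (-(T τ) - (3/2) * (1 - T τ) * Real.sin (2 * θ τ)))) := by
    intro τ hτ
    rw [(Set.EqOn.eventuallyEq_of_mem hT₁ (Ioo_mem_nhds hτ.1 hτ.2)).deriv_eq]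
    refine ((((hT τ hτ).const_mul 3).mul (((hT τ hτ).const_sub 1).pow 2)).mul
      ((hs τ hτ).pow 2)).deriv.trans ?_
    simp only [Pi.mul_apply, Pi.pow_apply]
    ring
  refine ⟨by simp [hT₁ τ₀ hτ₀, hsin], by simp [hT₂ τ₀ hτ₀, hsin], ?_⟩
  rw [(Set.EqOn.eventuallyEq_of_mem hT₂ (Ioo_mem_nhds hτ₀.1 hτ₀.2)).deriv_eq]
  have hTd : DifferentiableAt ℝ T τ₀ := (hT τ₀ hτ₀).differentiableAt
  have hθd : DifferentiableAt ℝ θ τ₀ := (hθ τ₀ hτ₀).differentiableAt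
  have hcos : Real.cos (θ τ₀) ^ 2 = 1 := by
    rw [Real.cos_sq', hsin]
    norm_num
  rw [deriv_fun_mul (by fun_prop) (by fun_prop), (hs τ₀ hτ₀).deriv, Real.sin_two_mul, hsin]
  linear_combination 6 * (T τ₀)^3 * (1 - T τ₀)^2 * hcos
end

section
/- Let (T, θ) be a solution of the system dT/dτ = 3T(1−T)²sin²θ, dθ/dτ = −T − (3/2)(1−T)sin(2θ) on an interval J with T(τ) ∈ (0,1) for all τ ∈ J. Then T is strictly increasing on J: for all τ₁, τ₂ ∈ J with τ₁ < τ₂ one has T(τ₁) < T(τ₂). -/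
open Real Set

/-- On any interval J where a solution of the system satisfies 0 < T < 1,
the function T is strictly increasing. -/
theorem stmt_2 (J : Set ℝ) (hJ : J.OrdConnected) (T θ : ℝ → ℝ)
    (hT : ∀ τ ∈ J, HasDerivAt T (3 * T τ * (1 - T τ)^2 * (Real.sin (θ τ))^2) τ)
    (hθ : ∀ τ ∈ J, HasDerivAt θ (-(T τ) - (3/2) * (1 - T τ) * Real.sin (2 * θ τ)) τ)
    (hrange : ∀ τ ∈ J, T τ ∈ Set.Ioo (0:ℝ) 1) :
    ∀ τ₁ ∈ J, ∀ τ₂ ∈ J, τ₁ < τ₂ → T τ₁ < T τ₂ := by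
  have hmono : MonotoneOn T J := by
    refine monotoneOn_of_deriv_nonneg hJ.convex
      (fun τ hτ => (hT τ hτ).continuousAt.continuousWithinAt)
      (fun τ hτ => (hT τ (interior_subset hτ)).differentiableAt.differentiableWithinAt)
      fun τ hτ => ?_
    have hτJ := interior_subset hτ
    rw [(hT τ hτJ).deriv]
    have := (hrange τ hτJ).1
    positivity
  intro a ha b hb hab
  by_contra! hle
  have hsub : Ioo a b ⊆ J := Ioo_subset_Icc_self.trans (hJ.out ha hb)
  have hconst : EqOn T (fun _ => T a) (Ioo a b) := fun τ hτ =>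
    le_antisymm ((hmono (hsub hτ) hb hτ.2.le).trans hle) (hmono ha (hsub hτ) hτ.1.le)
  have hsin : EqOn (fun τ => Real.sin (θ τ)) (fun _ => 0) (Ioo a b) := by
    intro τ hτ
    have hderiv := ((hasDerivAt_const τ (T a)).congr_of_eventuallyEq
      (hconst.eventuallyEq_of_mem (Ioo_mem_nhds hτ.1 hτ.2))).unique (hT τ (hsub hτ))
    obtain ⟨hpos, hlt⟩ := hrange τ (hsub hτ)
    have hne : 3 * T τ * (1 - T τ) ^ 2 ≠ 0 :=
      mul_ne_zero (by positivity) (pow_ne_zero 2 (sub_pos.2 hlt).ne')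
    exact pow_eq_zero_iff two_ne_zero |>.1 ((mul_eq_zero.1 hderiv.symm).resolve_left hne)
  obtain ⟨c, hc⟩ := nonempty_Ioo.2 hab
  have hderiv := ((hasDerivAt_const c (0 : ℝ)).congr_of_eventuallyEq
    (hsin.eventuallyEq_of_mem (Ioo_mem_nhds hc.1 hc.2))).unique (hθ c (hsub hc)).sin
  have hs : Real.sin (θ c) = 0 := hsin hc
  have hcos : Real.cos (θ c) ≠ 0 := fun h => by
    simpa [hs, h] using Real.sin_sq_add_cos_sq (θ c)
  have hTc := (hrange c (hsub hc)).1.ne'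
  simp [Real.sin_two_mul, hs, hcos, hTc] at hderiv
end

section
/- Let (T, θ) : ℝ → ℝ² be a global solution of the system dT/dτ = 3T(1−T)²sin²θ, dθ/dτ = −T − (3/2)(1−T)sin(2θ) with T(τ) ∈ (0,1) for all τ. Then T(τ) → 1 as τ → +∞, and θ(τ) → −∞ as τ → +∞. -/
open Real Set Filter

theorem tendsto_atBot_of_hasDerivAt_le_neg {f f' : ℝ → ℝ} {a t₀ : ℝ} (ha : 0 < a)
    (hf : ∀ t, HasDerivAt f (f' t) t) (hle : ∀ t, t₀ ≤ t → f' t ≤ -a) :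
    Tendsto f atTop atBot := by
  have hbound : ∀ t, t₀ ≤ t → f t ≤ f t₀ + -a * (t - t₀) := by
    intro t ht
    have := (convex_Ici t₀).image_sub_le_mul_sub_of_deriv_le
      (fun x _ => (hf x).continuousAt.continuousWithinAt)
      (fun x _ => (hf x).differentiableAt.differentiableWithinAt)
      (C := -a)
      (fun x hx => by rw [(hf x).deriv]; exact hle x (interior_subset hx))
      t₀ self_mem_Ici t ht ht
    linarith
  refine tendsto_atBot_mono' atTop ((eventually_ge_atTop t₀).mono hbound) ?_
  refine tendsto_atBot_add_const_left _ _ ?_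
  exact (tendsto_atTop_add_const_right _ (-t₀) tendsto_id).const_mul_atTop_of_neg (neg_neg_of_pos ha)

/-- The angular velocity, weighted by `cos 2θ`, is negative up to a multiple of `sin² θ`. -/
theorem cos_sq_sub_sin_sq_mul_le {T₀ T s c : ℝ} (hT₀ : 0 < T₀) (hT : T₀ ≤ T) (hT1 : T < 1)
    (hsc : s ^ 2 + c ^ 2 = 1) :
    (c ^ 2 - s ^ 2) * (-T - 3 / 2 * (1 - T) * (2 * s * c)) ≤
      -(T₀ / 2) + (8 + 9 / (2 * T₀)) * s ^ 2 := by
  have hc : c ^ 2 = 1 - s ^ 2 := by linarith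
  have hx : |s * c| ≤ 1 := by
    rw [abs_le]; constructor <;> nlinarith [sq_nonneg (s + c), sq_nonneg (s - c)]
  obtain ⟨hx1, hx2⟩ := abs_le.mp hx
  have hcubic : 6 * (1 - T) * (s * c) * s ^ 2 ≤ 6 * s ^ 2 := by
    have : (1 - T) * (s * c) ≤ 1 := by nlinarith
    nlinarith [sq_nonneg s]
  have hlin : -3 * (1 - T) * (s * c) ≤ T₀ / 2 + 9 / (2 * T₀) * s ^ 2 := by
    have hy : ((1 - T) * c) ^ 2 ≤ 1 := by
      rw [mul_pow]
      exact mul_le_one₀ (by nlinarith) (sq_nonneg c) (by nlinarith [sq_nonneg s])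
    have hsq : T₀ / 2 + 9 / (2 * T₀) * s ^ 2 + 3 * s * ((1 - T) * c) =
        (T₀ * ((1 - T) * c) + 3 * s) ^ 2 / (2 * T₀) + T₀ / 2 * (1 - ((1 - T) * c) ^ 2) := by
      field_simp
      ring
    have : 0 ≤ (T₀ * ((1 - T) * c) + 3 * s) ^ 2 / (2 * T₀) := by positivity
    have : 0 ≤ T₀ / 2 * (1 - ((1 - T) * c) ^ 2) := mul_nonneg (by linarith) (by linarith)
    linarith
  have hquad : 2 * T * s ^ 2 ≤ 2 * s ^ 2 := by nlinarith [sq_nonneg s]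
  rw [hc]
  linarith

/-- For any global solution with 0 < T < 1, T(τ) → 1 and θ(τ) → −∞
as τ → +∞. -/
theorem stmt_4 (T θ : ℝ → ℝ)
    (hT : ∀ τ : ℝ, HasDerivAt T (3 * T τ * (1 - T τ)^2 * (Real.sin (θ τ))^2) τ)
    (hθ : ∀ τ : ℝ, HasDerivAt θ (-(T τ) - (3/2) * (1 - T τ) * Real.sin (2 * θ τ)) τ)
    (hrange : ∀ τ : ℝ, T τ ∈ Set.Ioo (0:ℝ) 1) :
    Tendsto T atTop (nhds 1) ∧ Tendsto θ atTop atBot := by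
  have hmono : Monotone T := by
    refine monotone_of_deriv_nonneg (fun τ => (hT τ).differentiableAt) fun τ => ?_
    rw [(hT τ).deriv]
    have := (hrange τ).1
    positivity
  have hexceed : ∀ L < 1, ∃ τ, L < T τ := by
    intro L hL
    by_contra! hle
    have hT₀ := (hrange 0).1
    set c := 3 * T 0 * (1 - L) ^ 2 with hc
    have hcpos : 0 < c := by have := sub_pos.mpr hL; positivity
    set K := 8 + 9 / (2 * T 0) with hK
    have hKpos : 0 < K := by positivity
    have hlim : Tendsto (fun τ => sin (θ τ) * cos (θ τ) - K / c * T τ) atTop atBot := by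
      refine tendsto_atBot_of_hasDerivAt_le_neg (a := T 0 / 2) (t₀ := 0) (by linarith)
        (fun τ => ((hθ τ).sin.mul (hθ τ).cos).sub ((hT τ).const_mul (K / c))) fun τ hτ => ?_
      have hmain := cos_sq_sub_sin_sq_mul_le hT₀ (hmono hτ) (hrange τ).2
        (sin_sq_add_cos_sq (θ τ))
      have hgrowth : c * sin (θ τ) ^ 2 ≤ 3 * T τ * (1 - T τ) ^ 2 * sin (θ τ) ^ 2 := by
        have h0 := hmono hτ
        have h1 := hle τ
        rw [hc]
        have := sub_pos.mpr hL
        have := (hrange τ).1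
        gcongr
      have hscaled := mul_le_mul_of_nonneg_left hgrowth (div_pos hKpos hcpos).le
      rw [← mul_assoc, div_mul_cancel₀ _ hcpos.ne'] at hscaled
      rw [sin_two_mul]
      linarith
    obtain ⟨τ, hτ⟩ := (hlim.eventually_lt_atBot (-1 - K / c)).exists
    have h1 : K / c * T τ ≤ K / c :=
      mul_le_of_le_one_right (div_pos hKpos hcpos).le (hrange τ).2.le
    nlinarith [sin_sq_add_cos_sq (θ τ), sq_nonneg (sin (θ τ) + cos (θ τ))]
  refine ⟨tendsto_order.mpr ⟨fun L hL => ?_, fun L hL => ?_⟩, ?_⟩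
  · obtain ⟨t, ht⟩ := hexceed L hL
    exact (eventually_ge_atTop t).mono fun τ hτ => ht.trans_le (hmono hτ)
  · exact Eventually.of_forall fun τ => (hrange τ).2.trans hL
  · obtain ⟨t, ht⟩ := hexceed (3 / 4) (by norm_num)
    refine tendsto_atBot_of_hasDerivAt_le_neg (a := 3 / 8) (t₀ := t) (by norm_num) hθ
      fun τ hτ => ?_
    have := ht.trans_le (hmono hτ)
    nlinarith [neg_one_le_sin (2 * θ τ), (hrange τ).2]
end

section
/- Let (T, θ) : ℝ → ℝ² be a global solution of the system dT/dτ = 3T(1−T)²sin²θ, dθ/dτ = −T − (3/2)(1−T)sin(2θ) with T(τ) ∈ (0,1) for all τ. Then the periodic orbit on the boundary T = 1 is the ω-limit set of the solution: for every angle ψ ∈ ℝ there exists a strictly increasing sequence τₙ → +∞ such that T(τₙ) → 1 and θ(τₙ) − ψ ∈ 2πℤ for every n. -/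
open Real Set Filter

/-- A function whose derivative is at most `-r` on `[a, ∞)` satisfies `f y ≤ f x - r * (y - x)`. -/
lemma le_sub_mul_of_hasDerivAt_le {f f' : ℝ → ℝ} {a r : ℝ} (hf : ∀ τ, HasDerivAt f (f' τ) τ)
    (hle : ∀ τ, a ≤ τ → f' τ ≤ -r) {x y : ℝ} (hx : a ≤ x) (hxy : x ≤ y) :
    f y ≤ f x - r * (y - x) := by
  have h := Convex.image_sub_le_mul_sub_of_deriv_le (convex_Ici a)
    (fun τ _ => (hf τ).continuousAt.continuousWithinAt)
    (fun τ _ => (hf τ).differentiableAt.differentiableWithinAt) (C := -r)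
    (fun τ hτ => by
      rw [(hf τ).deriv]
      exact hle τ (interior_subset hτ))
    x hx y (hx.trans hxy) hxy
  linarith

/-- Along an interior orbit `T` is not bounded away from `1`. -/
lemma exists_lt_of_interior_orbit {T θ : ℝ → ℝ}
    (hT : ∀ τ : ℝ, HasDerivAt T (3 * T τ * (1 - T τ)^2 * (Real.sin (θ τ))^2) τ)
    (hθ : ∀ τ : ℝ, HasDerivAt θ (-(T τ) - (3/2) * (1 - T τ) * Real.sin (2 * θ τ)) τ)
    (hrange : ∀ τ : ℝ, T τ ∈ Set.Ioo (0:ℝ) 1) (hmono : Monotone T) {c : ℝ} (hc : c < 1) :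
    ∃ τ, c < T τ := by
  by_contra! hle
  obtain ⟨t, ht⟩ : ∃ t, t = T 0 := ⟨_, rfl⟩
  have ht0 : 0 < t := ht ▸ (hrange 0).1
  obtain ⟨K, hK⟩ : ∃ K, K = (2 + 9 / (2 * t)) / (3 * t * (1 - c)^2) := ⟨_, rfl⟩
  have hd : 0 < 3 * t * (1 - c)^2 := by
    have := sub_pos.2 hc
    positivity
  have hK0 : 0 ≤ K := by rw [hK]; positivity
  have hKd : K * (3 * t * (1 - c)^2) = 2 + 9 / (2 * t) := by
    rw [hK]; exact div_mul_cancel₀ _ hd.ne'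
  have hder : ∀ τ, HasDerivAt (fun τ => sin (2 * θ τ) / 2 - K * T τ)
      (cos (2 * θ τ) * (2 * (-(T τ) - (3/2) * (1 - T τ) * sin (2 * θ τ))) / 2
        - K * (3 * T τ * (1 - T τ)^2 * (sin (θ τ))^2)) τ := fun τ =>
    ((((hθ τ).const_mul 2).sin).div_const 2).sub ((hT τ).const_mul K)
  have hbound : ∀ τ, 0 ≤ τ → cos (2 * θ τ) * (2 * (-(T τ) - (3/2) * (1 - T τ) * sin (2 * θ τ))) / 2
        - K * (3 * T τ * (1 - T τ)^2 * (sin (θ τ))^2) ≤ -(t / 2) := by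
    intro τ hτ
    have htT : t ≤ T τ := ht ▸ hmono hτ
    have hT1 := (hrange τ).2
    have hTc := hle τ
    have hrate : 3 * t * (1 - c)^2 ≤ 3 * T τ * (1 - T τ)^2 := by
      have : 0 ≤ 1 - c := by linarith
      have := (hrange τ).1.le
      gcongr
    have hgain : (2 + 9 / (2 * t)) * sin (θ τ)^2
        ≤ K * (3 * T τ * (1 - T τ)^2 * (sin (θ τ))^2) := by
      rw [← hKd]
      calc K * (3 * t * (1 - c)^2) * sin (θ τ)^2
          ≤ K * (3 * T τ * (1 - T τ)^2) * sin (θ τ)^2 := by gcongr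
        _ = _ := by ring
    have hcos : cos (2 * θ τ) = 1 - 2 * sin (θ τ)^2 := by
      rw [cos_two_mul, cos_sq']; ring
    have hcross : -(cos (2 * θ τ) * ((3/2) * (1 - T τ) * sin (2 * θ τ))) ≤ 3 * |sin (θ τ)| := by
      refine (neg_le_abs _).trans ?_
      rw [sin_two_mul, abs_mul, abs_mul, abs_mul, abs_mul, abs_mul,
        abs_of_pos (by norm_num : (0:ℝ) < 3/2), abs_of_pos (by norm_num : (0:ℝ) < 2),
        abs_of_pos (by linarith : 0 < 1 - T τ)]
      have h1 := abs_cos_le_one (2 * θ τ)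
      have h2 := abs_cos_le_one (θ τ)
      calc |cos (2 * θ τ)| * (3/2 * (1 - T τ) * (2 * |sin (θ τ)| * |cos (θ τ)|))
          ≤ 1 * (3/2 * 1 * (2 * |sin (θ τ)| * 1)) := by
            have : 0 ≤ 1 - T τ := by linarith
            gcongr
            linarith
        _ = _ := by ring
    have hyoung : 3 * |sin (θ τ)| ≤ t / 2 + 9 / (2 * t) * sin (θ τ)^2 := by
      rw [← sq_abs (sin (θ τ))]
      have h := div_nonneg (sq_nonneg (t - 3 * |sin (θ τ)|)) (by positivity : 0 ≤ 2 * t)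
      have e : (t - 3 * |sin (θ τ)|)^2 / (2 * t)
          = t / 2 + 9 / (2 * t) * |sin (θ τ)|^2 - 3 * |sin (θ τ)| := by
        field_simp
        ring
      linarith
    have hTs : T τ * sin (θ τ)^2 ≤ sin (θ τ)^2 :=
      mul_le_of_le_one_left (sq_nonneg _) hT1.le
    have hTcos : -(T τ * cos (2 * θ τ)) = -T τ + 2 * (T τ * sin (θ τ)^2) := by
      rw [hcos]; ring
    linarith
  obtain ⟨s, hs⟩ : ∃ s, s = (2 + K) / (t / 2) := ⟨_, rfl⟩
  have hs0 : 0 ≤ s := by rw [hs]; positivity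
  have hst : t / 2 * s = 2 + K := by rw [hs]; field_simp
  have h := le_sub_mul_of_hasDerivAt_le hder hbound le_rfl hs0
  have h1 := neg_one_le_sin (2 * θ s)
  have h2 := sin_le_one (2 * θ 0)
  have h3 : K * T s ≤ K := mul_le_of_le_one_right hK0 (hrange s).2.le
  have h4 : 0 ≤ K * T 0 := mul_nonneg hK0 (hrange 0).1.le
  simp only [sub_zero] at h
  linarith

/-- The periodic orbit at T = 1 is the ω-limit set of any interior solution:
for each angle ψ there is a strictly increasing sequence τₙ → +∞ along which T → 1 and
θ ≡ ψ (mod 2π). -/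
theorem stmt_5 (T θ : ℝ → ℝ)
    (hT : ∀ τ : ℝ, HasDerivAt T (3 * T τ * (1 - T τ)^2 * (Real.sin (θ τ))^2) τ)
    (hθ : ∀ τ : ℝ, HasDerivAt θ (-(T τ) - (3/2) * (1 - T τ) * Real.sin (2 * θ τ)) τ)
    (hrange : ∀ τ : ℝ, T τ ∈ Set.Ioo (0:ℝ) 1) :
    ∀ ψ : ℝ, ∃ τs : ℕ → ℝ,
      StrictMono τs ∧ Tendsto τs atTop atTop ∧
      Tendsto (fun n => T (τs n)) atTop (nhds 1) ∧
      ∀ n : ℕ, ∃ k : ℤ, θ (τs n) - ψ = 2 * π * k := by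
  intro ψ
  have hmono : Monotone T := monotone_of_hasDerivAt_nonneg hT fun τ => by
    have := (hrange τ).1.le
    simp only [Pi.zero_apply]
    positivity
  have hlim : Tendsto T atTop (nhds 1) := by
    refine tendsto_order.2 ⟨fun c hc => ?_, fun c hc => ?_⟩
    · obtain ⟨s, hs⟩ := exists_lt_of_interior_orbit hT hθ hrange hmono hc
      filter_upwards [eventually_ge_atTop s] with τ hτ using hs.trans_le (hmono hτ)
    · exact Eventually.of_forall fun τ => (hrange τ).2.trans hc
  obtain ⟨a, ha⟩ := exists_lt_of_interior_orbit hT hθ hrange hmono (by norm_num : (4/5 : ℝ) < 1)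
  have hdec : ∀ {x y}, a ≤ x → x ≤ y → θ y ≤ θ x - 1/2 * (y - x) := by
    refine le_sub_mul_of_hasDerivAt_le hθ fun τ hτ => ?_
    have h1 := ha.trans_le (hmono hτ)
    have h2 := (hrange τ).2
    nlinarith [neg_one_le_sin (2 * θ τ)]
  have hcont : Continuous θ := continuous_iff_continuousAt.2 fun τ => (hθ τ).continuousAt
  obtain ⟨N, hN⟩ := exists_nat_ge ((ψ - θ a) / (2 * π))
  rw [div_le_iff₀ two_pi_pos] at hN
  have hhit : ∀ n : ℕ, ∃ τ, a ≤ τ ∧ θ τ = ψ - 2 * π * (N + n : ℕ) := by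
    intro n
    obtain ⟨v, hv⟩ : ∃ v, v = ψ - 2 * π * (N + n : ℕ) := ⟨_, rfl⟩
    have hva : v ≤ θ a := by
      have : 0 ≤ 2 * π * n := by positivity
      rw [hv]; push_cast; linarith
    have hab : a ≤ a + 2 * (θ a - v) := by linarith
    have hb := hdec le_rfl hab
    obtain ⟨τ, hτ, e⟩ := intermediate_value_Icc' hab hcont.continuousOn
      (⟨by linarith, hva⟩ : v ∈ Icc (θ (a + 2 * (θ a - v))) (θ a))
    exact ⟨τ, hτ.1, e.trans hv⟩
  choose τs hτa hτs using hhit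
  have hlt : ∀ {x y}, a ≤ x → θ y < θ x → x < y ∨ y < a := by
    intro x y hx h
    by_contra! hyx
    linarith [hdec hyx.2 hyx.1]
  have hstrict : StrictMono τs := by
    intro m n hmn
    have hmn' : (m : ℝ) < n := by exact_mod_cast hmn
    refine (hlt (hτa m) ?_).resolve_right (hτa n).not_gt
    rw [hτs, hτs]
    push_cast
    nlinarith [pi_pos]
  have htop : Tendsto τs atTop atTop := by
    refine tendsto_atTop_atTop_of_monotone hstrict.monotone fun b => ?_
    obtain ⟨n, hn⟩ := exists_nat_gt ((ψ - θ (max b a)) / (2 * π))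
    rw [div_lt_iff₀ two_pi_pos] at hn
    refine ⟨n, (le_max_left b a).trans
      ((hlt (le_max_right b a) ?_).resolve_right (hτa n).not_gt).le⟩
    have : 0 ≤ 2 * π * N := by positivity
    rw [hτs]
    push_cast
    linarith
  refine ⟨τs, hstrict, htop, hlim.comp htop, fun n => ⟨-(N + n : ℕ), ?_⟩⟩
  rw [hτs]
  push_cast
  ring
end

section
/- Let (T, θ) : ℝ → ℝ² be a global solution of the system dT/dτ = 3T(1−T)²sin²θ, dθ/dτ = −T − (3/2)(1−T)sin(2θ) with T(τ) ∈ (0,1) for all τ, and let q(τ) := −1 + 3sin²θ(τ) be the deceleration parameter. Then limsup_{τ→+∞} q(τ) = 2 and liminf_{τ→+∞} q(τ) = −1; in particular q has no limit as τ → +∞ (asymptotic manifest self-similarity is broken toward the future). -/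
open Real Set Filter

theorem mul_sub_le_sub_of_le_hasDerivAt {f f' : ℝ → ℝ} {a c : ℝ}
    (hf : ∀ x, HasDerivAt f (f' x) x) (hc : ∀ x, a ≤ x → c ≤ f' x) {x y : ℝ}
    (hx : a ≤ x) (hxy : x ≤ y) : c * (y - x) ≤ f y - f x := by
  refine (convex_Ici a).mul_sub_le_image_sub_of_le_deriv
    (fun z _ => (hf z).continuousAt.continuousWithinAt)
    (fun z _ => (hf z).differentiableAt.differentiableWithinAt) (fun z hz => ?_)
    x hx y (le_trans hx hxy) hxy
  rw [(hf z).deriv]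
  exact hc z (interior_subset hz)

theorem tendsto_atBot_of_hasDerivAt_le {f f' : ℝ → ℝ} {a c : ℝ} (hc : 0 < c)
    (hf : ∀ x, HasDerivAt f (f' x) x) (hle : ∀ x, a ≤ x → f' x ≤ -c) :
    Tendsto f atTop atBot := by
  have hlin : Tendsto (fun x => f a - c * (x - a)) atTop atBot :=
    tendsto_const_nhds.add_atBot (tendsto_neg_atTop_atBot.comp
      ((tendsto_atTop_add_const_right _ (-a) tendsto_id).const_mul_atTop hc))
  refine tendsto_atBot_mono' _ ?_ hlin
  filter_upwards [eventually_ge_atTop a] with x hx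
  have := mul_sub_le_sub_of_le_hasDerivAt (f := fun x => -f x) (f' := fun x => -f' x) (c := c)
    (fun x => (hf x).neg) (fun x hx => by linarith [hle x hx]) le_rfl hx
  linarith

/-- A continuous function tending to `-∞` attains frequently every value modulo `π`. -/
theorem frequently_eq_sub_nat_mul_pi {f : ℝ → ℝ} (hcont : Continuous f)
    (hf : Tendsto f atTop atBot) (b : ℝ) : ∃ᶠ x in atTop, ∃ n : ℕ, f x = b - n * π := by
  rw [frequently_atTop]
  intro a
  obtain ⟨n, hn⟩ := exists_nat_ge ((b - f a) / π)
  rw [div_le_iff₀ pi_pos] at hn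
  obtain ⟨y, hy, hay⟩ :=
    ((hf.eventually_le_atBot (b - n * π)).and (eventually_ge_atTop a)).exists
  obtain ⟨x, hx, hxe⟩ := intermediate_value_Icc' hay hcont.continuousOn
    ⟨hy, (by linarith : b - n * π ≤ f a)⟩
  exact ⟨x, hx.1, n, hxe⟩

/-- The derivative of `-sin θ cos θ` along the flow is bounded below where `T ≥ t`, up to a
multiple of `sin² θ`. -/
theorem le_neg_cos_two_mul_mul {t T s c : ℝ} (ht : 0 < t) (htT : t ≤ T) (hT : T ≤ 1)
    (hsc : s ^ 2 + c ^ 2 = 1) :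
    t / 2 - (2 + 9 / (2 * t)) * s ^ 2 ≤ (c ^ 2 - s ^ 2) * (T + 3 * (1 - T) * (s * c)) := by
  have hk : 3 * |s| ≤ t / 2 + 9 / (2 * t) * s ^ 2 := by
    have : t / 2 + 9 / (2 * t) * s ^ 2 - 3 * |s| = (t - 3 * |s|) ^ 2 / (2 * t) := by
      field_simp
      rw [← sq_abs s]
      ring
    have : 0 ≤ (t - 3 * |s|) ^ 2 / (2 * t) := by positivity
    linarith
  have hc : |c| ≤ 1 := abs_le_one_iff_mul_self_le_one.2 (by nlinarith [sq_nonneg s])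
  have hd : |c ^ 2 - s ^ 2| ≤ 1 :=
    abs_le.2 ⟨by nlinarith [sq_nonneg s, sq_nonneg c], by nlinarith [sq_nonneg s, sq_nonneg c]⟩
  have hT' : |1 - T| ≤ 1 := abs_le.2 ⟨by linarith, by linarith⟩
  have hprod : |(c ^ 2 - s ^ 2) * (1 - T) * c * s| ≤ |s| := by
    rw [abs_mul]
    refine mul_le_of_le_one_left (abs_nonneg s) ?_
    rw [abs_mul, abs_mul]
    exact mul_le_one₀ (mul_le_one₀ hd (abs_nonneg _) hT') (abs_nonneg _) hc
  have hTs : T * s ^ 2 ≤ s ^ 2 := mul_le_of_le_one_left (sq_nonneg s) hT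
  have hc2 : c ^ 2 = 1 - s ^ 2 := by linarith
  have hexp : (c ^ 2 - s ^ 2) * (T + 3 * (1 - T) * (s * c)) =
      T - 2 * (T * s ^ 2) + 3 * ((c ^ 2 - s ^ 2) * (1 - T) * c * s) := by
    linear_combination T * hc2
  rw [hexp]
  linarith [neg_abs_le ((c ^ 2 - s ^ 2) * (1 - T) * c * s)]

theorem exists_three_quarters_lt (T θ : ℝ → ℝ)
    (hT : ∀ τ : ℝ, HasDerivAt T (3 * T τ * (1 - T τ)^2 * (Real.sin (θ τ))^2) τ)
    (hθ : ∀ τ : ℝ, HasDerivAt θ (-(T τ) - (3/2) * (1 - T τ) * Real.sin (2 * θ τ)) τ)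
    (hrange : ∀ τ : ℝ, T τ ∈ Set.Ioo (0:ℝ) 1) (hmono : Monotone T) :
    ∃ τ, 3 / 4 < T τ := by
  by_contra! hle
  set t := T 0
  have ht : 0 < t := (hrange 0).1
  set K := 2 + 9 / (2 * t)
  have hK : 0 < K := by positivity
  set A := K * (16 / (3 * t))
  have hA : 0 < A := by positivity
  set W' : ℝ → ℝ := fun τ =>
    (cos (θ τ) ^ 2 - sin (θ τ) ^ 2) * (T τ + 3 * (1 - T τ) * (sin (θ τ) * cos (θ τ))) +
      A * (3 * T τ * (1 - T τ)^2 * (sin (θ τ))^2)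
  have hW : ∀ τ, HasDerivAt (fun τ => -(sin (θ τ) * cos (θ τ)) + A * T τ) (W' τ) τ := by
    intro τ
    refine (((hθ τ).sin.mul (hθ τ).cos).neg.add ((hT τ).const_mul A)).congr_deriv ?_
    simp only [W', sin_two_mul]
    ring
  have hW' : ∀ τ, 0 ≤ τ → t / 2 ≤ W' τ := by
    intro τ hτ
    have h1 := le_neg_cos_two_mul_mul ht (hmono hτ) (hrange τ).2.le (sin_sq_add_cos_sq (θ τ))
    have h2 : 3 * t / 16 * sin (θ τ) ^ 2 ≤ 3 * T τ * (1 - T τ)^2 * (sin (θ τ))^2 := by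
      have h3 : (1 / 4 : ℝ) ^ 2 ≤ (1 - T τ) ^ 2 := by
        gcongr
        linarith [hle τ]
      refine mul_le_mul_of_nonneg_right ?_ (sq_nonneg _)
      calc 3 * t / 16 = 3 * t * (1 / 4) ^ 2 := by ring
        _ ≤ 3 * T τ * (1 - T τ) ^ 2 := by
          have : t ≤ T τ := hmono hτ
          have := (hrange τ).1
          gcongr
    have h4 : K * sin (θ τ) ^ 2 = A * (3 * t / 16 * sin (θ τ) ^ 2) := by
      simp only [A]
      field_simp
    have h5 := mul_le_mul_of_nonneg_left h2 hA.le
    simp only [W']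
    linarith
  have hbound : ∀ τ, |-(sin (θ τ) * cos (θ τ)) + A * T τ| ≤ 1 + A := by
    intro τ
    have h1 : |sin (θ τ) * cos (θ τ)| ≤ 1 := by
      rw [abs_mul]
      exact mul_le_one₀ (abs_sin_le_one _) (abs_nonneg _) (abs_cos_le_one _)
    have h2 : A * T τ ≤ A := mul_le_of_le_one_right hA.le (hrange τ).2.le
    have h3 : 0 ≤ A * T τ := mul_nonneg hA.le (hrange τ).1.le
    rw [abs_le] at h1 ⊢
    constructor <;> linarith
  have hB : 0 ≤ (2 * (1 + A) + 1) * (2 / t) := by positivity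
  have hgrow := mul_sub_le_sub_of_le_hasDerivAt hW hW' le_rfl hB
  have h1 := (abs_le.1 (hbound ((2 * (1 + A) + 1) * (2 / t)))).2
  have h2 := (abs_le.1 (hbound 0)).1
  have h3 : t / 2 * ((2 * (1 + A) + 1) * (2 / t) - 0) = 2 * (1 + A) + 1 := by
    field_simp
    ring
  linarith

theorem tendsto_angle_atBot (T θ : ℝ → ℝ)
    (hT : ∀ τ : ℝ, HasDerivAt T (3 * T τ * (1 - T τ)^2 * (Real.sin (θ τ))^2) τ)
    (hθ : ∀ τ : ℝ, HasDerivAt θ (-(T τ) - (3/2) * (1 - T τ) * Real.sin (2 * θ τ)) τ)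
    (hrange : ∀ τ : ℝ, T τ ∈ Set.Ioo (0:ℝ) 1) : Tendsto θ atTop atBot := by
  have hmono : Monotone T := monotone_of_hasDerivAt_nonneg hT fun τ => by
    have := (hrange τ).1
    simp only [Pi.zero_apply]
    positivity
  obtain ⟨a, ha⟩ := exists_three_quarters_lt T θ hT hθ hrange hmono
  refine tendsto_atBot_of_hasDerivAt_le (a := a) (c := 3 / 8) (by norm_num) hθ fun τ hτ => ?_
  have h1 := hmono hτ
  have h2 := mul_le_mul_of_nonneg_left (neg_one_le_sin (2 * θ τ))
    (by linarith [(hrange τ).2] : 0 ≤ 1 - T τ)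
  linarith

/-- Along any interior global solution, the deceleration parameter
q = −1 + 3sin²θ has limsup 2 and liminf −1 as τ → +∞, and in particular has no limit:
asymptotic manifest self-similarity is broken toward the future. -/
theorem stmt_6 (T θ : ℝ → ℝ)
    (hT : ∀ τ : ℝ, HasDerivAt T (3 * T τ * (1 - T τ)^2 * (Real.sin (θ τ))^2) τ)
    (hθ : ∀ τ : ℝ, HasDerivAt θ (-(T τ) - (3/2) * (1 - T τ) * Real.sin (2 * θ τ)) τ)
    (hrange : ∀ τ : ℝ, T τ ∈ Set.Ioo (0:ℝ) 1)
    (q : ℝ → ℝ) (hq : q = fun τ => -1 + 3 * (Real.sin (θ τ))^2) :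
    Filter.limsup q atTop = 2 ∧ Filter.liminf q atTop = -1 ∧
      ¬ ∃ L : ℝ, Tendsto q atTop (nhds L) := by
  have hbot := tendsto_angle_atBot T θ hT hθ hrange
  have hcont : Continuous θ := continuous_iff_continuousAt.2 fun τ => (hθ τ).continuousAt
  have hle : ∀ τ, q τ ≤ 2 := fun τ => by
    rw [hq]
    linarith [sin_sq_le_one (θ τ)]
  have hge : ∀ τ, -1 ≤ q τ := fun τ => by
    rw [hq]
    linarith [sq_nonneg (sin (θ τ))]
  have hfreq2 : ∃ᶠ τ in atTop, 2 ≤ q τ := by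
    refine (frequently_eq_sub_nat_mul_pi hcont hbot (π / 2)).mono ?_
    rintro τ ⟨n, hn⟩
    simp only [hq, hn, sin_sub_nat_mul_pi, mul_pow, sin_pi_div_two, ← pow_mul, mul_comm n 2]
    norm_num [pow_mul]
  have hfreq1 : ∃ᶠ τ in atTop, q τ ≤ -1 := by
    refine (frequently_eq_sub_nat_mul_pi hcont hbot 0).mono ?_
    rintro τ ⟨n, hn⟩
    simp [hq, hn]
  have hbdd : IsBoundedUnder (· ≤ ·) atTop q := isBoundedUnder_of ⟨2, hle⟩
  have hbdd' : IsBoundedUnder (· ≥ ·) atTop q := isBoundedUnder_of ⟨-1, hge⟩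
  have hsup : limsup q atTop = 2 :=
    le_antisymm (limsup_le_of_le hbdd'.isCoboundedUnder_le (.of_forall hle))
      (le_limsup_of_frequently_le hfreq2 hbdd)
  have hinf : liminf q atTop = -1 :=
    le_antisymm (liminf_le_of_frequently_le hfreq1 hbdd')
      (le_liminf_of_le hbdd.isCoboundedUnder_ge (.of_forall hge))
  refine ⟨hsup, hinf, ?_⟩
  rintro ⟨L, hL⟩
  have h1 := hL.limsup_eq
  have h2 := hL.liminf_eq
  linarith
end

section
/- Let (T, θ) : ℝ → ℝ² be a global solution of the system dT/dτ = 3T(1−T)²sin²θ, dθ/dτ = −T − (3/2)(1−T)sin(2θ) with T(τ) ∈ (0,1) for all τ. Then T(τ) → 0 as τ → −∞ (every interior orbit originates from the invariant boundary T = 0, where H → ∞). -/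
open Real Set Filter

/-- The pointwise bound behind the strict growth of `K * T - sin θ * cos θ`. -/
lemma half_le_deriv_aux {ε K m t s c : ℝ} (hε : 0 < ε) (hm : 0 ≤ m) (hεt : ε ≤ t) (htm : t ≤ 1 - m)
    (hK0 : 0 ≤ K) (hK : K * (3 * ε * m ^ 2) = 9 / (2 * ε) + 8) (hsc : s ^ 2 + c ^ 2 = 1) :
    ε / 2 ≤ K * (3 * t * (1 - t) ^ 2 * s ^ 2)
      - (c ^ 2 - s ^ 2) * (-t - (3 / 2) * (1 - t) * (2 * s * c)) := by
  have ht1 : t ≤ 1 := by linarith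
  have hgrow : (9 / (2 * ε) + 8) * s ^ 2 ≤ K * (3 * t * (1 - t) ^ 2 * s ^ 2) := by
    rw [← hK]
    have : 3 * ε * m ^ 2 ≤ 3 * t * (1 - t) ^ 2 := by
      have : m ≤ 1 - t := by linarith
      have : 0 ≤ t := hε.le.trans hεt
      gcongr
    calc K * (3 * ε * m ^ 2) * s ^ 2 = K * ((3 * ε * m ^ 2) * s ^ 2) := by ring
      _ ≤ _ := by gcongr
  have hc : |c| ≤ 1 := abs_le_one_iff_mul_self_le_one.2 (by nlinarith [sq_nonneg s])
  have hs : |s| ≤ 1 := abs_le_one_iff_mul_self_le_one.2 (by nlinarith [sq_nonneg c])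
  have hcross : |3 * (1 - t) * (s * c)| ≤ 3 * |s| := by
    rw [abs_mul, abs_mul, abs_mul, abs_of_nonneg (show (0 : ℝ) ≤ 1 - t by linarith),
      abs_of_pos (show (0 : ℝ) < 3 by norm_num)]
    have h1 : |s| * |c| ≤ |s| := mul_le_of_le_one_right (abs_nonneg s) hc
    calc 3 * (1 - t) * (|s| * |c|) ≤ 3 * 1 * |s| := by
          gcongr
          linarith
      _ = 3 * |s| := by ring
  have hyoung : 3 * |s| ≤ ε / 2 + 9 / (2 * ε) * s ^ 2 := by
    have h : ε / 2 + 9 / (2 * ε) * s ^ 2 - 3 * |s| = (ε - 3 * |s|) ^ 2 / (2 * ε) := by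
      rw [← sq_abs s]
      field_simp
      ring
    have : 0 ≤ (ε - 3 * |s|) ^ 2 / (2 * ε) := by positivity
    linarith
  have hquad : s ^ 2 * (t + 3 * (1 - t) * (s * c)) ≤ s ^ 2 * 4 := by
    gcongr
    linarith [le_abs_self (3 * (1 - t) * (s * c))]
  have hlow := neg_abs_le (3 * (1 - t) * (s * c))
  have hc2 : c ^ 2 = 1 - s ^ 2 := by linarith
  rw [hc2]
  linarith

/-- Every interior global solution satisfies T(τ) → 0 as τ → −∞. -/
theorem stmt_7 (T θ : ℝ → ℝ)
    (hT : ∀ τ : ℝ, HasDerivAt T (3 * T τ * (1 - T τ)^2 * (Real.sin (θ τ))^2) τ)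
    (hθ : ∀ τ : ℝ, HasDerivAt θ (-(T τ) - (3/2) * (1 - T τ) * Real.sin (2 * θ τ)) τ)
    (hrange : ∀ τ : ℝ, T τ ∈ Set.Ioo (0:ℝ) 1) :
    Tendsto T atBot (nhds 0) := by
  have hmono : Monotone T := monotone_of_hasDerivAt_nonneg hT fun τ => by
    have := (hrange τ).1
    show 0 ≤ 3 * T τ * (1 - T τ) ^ 2 * (Real.sin (θ τ)) ^ 2
    positivity
  suffices hsmall : ∀ ε > 0, ∃ τ, T τ < ε by
    refine tendsto_order.2 ⟨fun a ha => .of_forall fun τ => ha.trans (hrange τ).1, fun ε hε => ?_⟩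
    obtain ⟨τ₀, hτ₀⟩ := hsmall ε hε
    filter_upwards [eventually_le_atBot τ₀] with τ hτ using (hmono hτ).trans_lt hτ₀
  intro ε hε
  by_contra! hge
  set m := 1 - T 0 with hm_def
  have hm : 0 < m := by linarith [(hrange 0).2]
  set K := (9 / (2 * ε) + 8) / (3 * ε * m ^ 2) with hK_def
  have hK0 : 0 ≤ K := by positivity
  have hK : K * (3 * ε * m ^ 2) = 9 / (2 * ε) + 8 := div_mul_cancel₀ _ (by positivity)
  have hderiv (τ : ℝ) := (((hT τ).const_mul K).sub ((hθ τ).sin.mul (hθ τ).cos)).sub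
    ((hasDerivAt_id τ).const_mul (ε / 2))
  have hG : MonotoneOn (fun τ => K * T τ - sin (θ τ) * cos (θ τ) - ε / 2 * τ) (Iic 0) := by
    refine monotoneOn_of_hasDerivWithinAt_nonneg (convex_Iic 0)
      (fun τ _ => (hderiv τ).continuousAt.continuousWithinAt)
      (fun τ _ => (hderiv τ).hasDerivWithinAt) fun τ hτ => ?_
    have hτ0 : τ ∈ Iic (0 : ℝ) := interior_subset hτ
    have h := half_le_deriv_aux hε hm.le (hge τ) (by linarith [hmono (mem_Iic.1 hτ0)]) hK0 hK
      (sin_sq_add_cos_sq (θ τ))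
    rw [← sin_two_mul] at h
    linarith
  have hbound : ∀ τ, |sin (θ τ) * cos (θ τ)| ≤ 1 := fun τ => by
    rw [abs_mul]
    exact mul_le_one₀ (abs_sin_le_one _) (abs_nonneg _) (abs_cos_le_one _)
  set M := 2 / ε * (K + 3) with hM_def
  have hM : ε / 2 * M = K + 3 := by
    rw [hM_def]
    field_simp
  have hM0 : 0 ≤ M := by positivity
  have hcmp := hG (show -M ∈ Iic 0 by simpa using hM0) (show (0 : ℝ) ∈ Iic 0 by simp)
    (by linarith)
  simp only [mul_neg, mul_zero, hM] at hcmp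
  have h0 : K * T 0 ≤ K := mul_le_of_le_one_right hK0 (hrange 0).2.le
  have h1 : 0 ≤ K * T (-M) := mul_nonneg hK0 (hrange _).1.le
  linarith [(abs_le.1 (hbound 0)).1, (abs_le.1 (hbound (-M))).2]
end

section
/- A point (T₀, θ₀) with T₀ ∈ [0,1] is a fixed point of the vector field F(T, θ) = (3T(1−T)²sin²θ, −T − (3/2)(1−T)sin(2θ)) (i.e. F(T₀, θ₀) = (0,0)) if and only if T₀ = 0 and sin(2θ₀) = 0, i.e. if and only if T₀ = 0 and θ₀ is an integer multiple of π/2. (The fixed points with θ₀ ∈ πℤ are the de Sitter points dS±, and those with θ₀ an odd multiple of π/2 are the massless scalar field points M±.) -/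
open Real Set

/-- A point (T₀, θ₀) with T₀ ∈ [0,1] is a fixed point of the vector field
F(T,θ) = (3T(1−T)²sin²θ, −T − (3/2)(1−T)sin 2θ) iff T₀ = 0 and sin 2θ₀ = 0, i.e. iff
T₀ = 0 and θ₀ is an integer multiple of π/2. -/
theorem stmt_8 (T₀ θ₀ : ℝ) (hT₀ : T₀ ∈ Set.Icc (0:ℝ) 1) :
    ((3 * T₀ * (1 - T₀)^2 * (Real.sin θ₀)^2 = 0 ∧
        -T₀ - (3/2) * (1 - T₀) * Real.sin (2 * θ₀) = 0)
      ↔ (T₀ = 0 ∧ Real.sin (2 * θ₀) = 0)) ∧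
    ((3 * T₀ * (1 - T₀)^2 * (Real.sin θ₀)^2 = 0 ∧
        -T₀ - (3/2) * (1 - T₀) * Real.sin (2 * θ₀) = 0)
      ↔ (T₀ = 0 ∧ ∃ n : ℤ, θ₀ = n * (π / 2))) := by
  have hfixed : (3 * T₀ * (1 - T₀)^2 * (Real.sin θ₀)^2 = 0 ∧
      -T₀ - (3/2) * (1 - T₀) * Real.sin (2 * θ₀) = 0)
      ↔ (T₀ = 0 ∧ Real.sin (2 * θ₀) = 0) := by
    constructor
    · rintro ⟨h₁, h₂⟩
      have hT : T₀ = 0 := by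
        rcases mul_eq_zero.mp h₁ with h | h
        · rcases mul_eq_zero.mp h with h | h
          · linarith
          · have h_one : 1 - T₀ = 0 := pow_eq_zero_iff two_ne_zero |>.mp h
            rw [h_one] at h₂
            linarith
        · have h_sin : Real.sin θ₀ = 0 := pow_eq_zero_iff two_ne_zero |>.mp h
          rw [Real.sin_two_mul, h_sin] at h₂
          linarith
      subst hT
      exact ⟨rfl, by linarith⟩
    · rintro ⟨rfl, h⟩
      simp [h]
  have hsin : Real.sin (2 * θ₀) = 0 ↔ ∃ n : ℤ, θ₀ = n * (π / 2) := by
    rw [Real.sin_eq_zero_iff]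
    refine exists_congr fun n => ⟨fun h => ?_, fun h => ?_⟩ <;> linarith
  exact ⟨hfixed, hfixed.trans (and_congr_right fun _ => hsin)⟩
end

section
/- There exists a global solution (T, θ) : ℝ → ℝ² of the system dT/dτ = 3T(1−T)²sin²θ, dθ/dτ = −T − (3/2)(1−T)sin(2θ) with T(τ) ∈ (0,1) for all τ and (T(τ), θ(τ)) → (0, 0) as τ → −∞ (the 'attractor solution' originating from the de Sitter point dS₊); moreover it is unique up to time translation: if (T₁, θ₁) and (T₂, θ₂) are two such solutions, then there exists c ∈ ℝ with T₂(τ) = T₁(τ + c) and θ₂(τ) = θ₁(τ + c) for all τ. -/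
open Real Set Filter

/-- A bounded Lipschitz autonomous vector field has a global integral curve through each point. -/
lemma exists_global_solution_of_lipschitz_bounded {E : Type*} [NormedAddCommGroup E]
    [NormedSpace ℝ E] [CompleteSpace E] {v : E → E} {K L : NNReal} (hK : LipschitzWith K v)
    (hL : ∀ x, ‖v x‖ ≤ L) (x₀ : E) :
    ∃ γ : ℝ → E, γ 0 = x₀ ∧ ∀ t, HasDerivAt γ (v (γ t)) t := by
  have hloc : ∀ n : ℕ, ∃ α : ℝ → E, α 0 = x₀ ∧
      ∀ t ∈ Ioo (-(n + 1 : ℝ)) (n + 1), HasDerivAt α (v (α t)) t := by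
    intro n
    have hn : (0 : ℝ) < n + 1 := by positivity
    let t₀ : Icc (-(n + 1 : ℝ)) (n + 1) := ⟨0, by constructor <;> linarith⟩
    have hP : IsPicardLindelof (fun _ ↦ v) t₀ x₀ (L * (n + 1)) 0 L K :=
      IsPicardLindelof.of_time_independent (fun x _ ↦ hL x) hK.lipschitzOnWith (by simp [t₀])
    obtain ⟨α, h0, hα⟩ := hP.exists_eq_forall_mem_Icc_hasDerivWithinAt₀
    exact ⟨α, h0, fun t ht ↦ (hα t (Ioo_subset_Icc_self ht)).hasDerivAt (Icc_mem_nhds ht.1 ht.2)⟩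
  choose α h0 hα using hloc
  have hagree : ∀ m n : ℕ, m ≤ n → EqOn (α m) (α n) (Ioo (-(m + 1 : ℝ)) (m + 1)) := by
    intro m n hmn
    have hm : (0 : ℝ) < m + 1 := by positivity
    have hmn' : (m : ℝ) ≤ n := by exact_mod_cast hmn
    refine ODE_solution_unique_of_mem_Ioo (v := fun _ ↦ v) (s := fun _ ↦ univ) (K := K) (t₀ := 0)
      (fun _ _ ↦ hK.lipschitzOnWith) ⟨by linarith, hm⟩ (fun t ht ↦ ⟨hα m t ht, trivial⟩)
      (fun t ht ↦ ⟨hα n t ⟨by linarith [ht.1], by linarith [ht.2]⟩, trivial⟩) ?_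
    rw [h0, h0]
  refine ⟨fun t ↦ α ⌈|t|⌉₊ t, by simp [h0], fun t ↦ ?_⟩
  set N := ⌈|t|⌉₊ + 1 with hN
  have habs : ∀ s : ℝ, ∀ n : ℕ, |s| ≤ n → s ∈ Ioo (-(n + 1 : ℝ)) (n + 1) := by
    intro s n hs
    have := abs_le.1 hs
    constructor <;> linarith [this.1, this.2]
  have ht : |t| < N := by
    have := Nat.le_ceil |t|
    rw [hN]; push_cast; linarith
  have hev : (fun s : ℝ ↦ α ⌈|s|⌉₊ s) =ᶠ[nhds t] α N := by
    have : ∀ᶠ s : ℝ in nhds t, |s| < (N : ℝ) := (continuous_abs.tendsto t).eventually_lt_const ht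
    filter_upwards [this] with s hs
    exact hagree _ _ (Nat.ceil_le.2 hs.le) (habs s _ (Nat.le_ceil _))
  have hval : α ⌈|t|⌉₊ t = α N t := hev.eq_of_nhds
  have := (hα N t (habs t N ht.le)).congr_of_eventuallyEq hev
  simpa only [hval] using this

/-- If `w → 0` at `-∞` and `w` decreases wherever it is positive, then `w ≤ 0`. -/
lemma nonpos_of_tendsto_zero_atBot_of_deriv_neg {w w' : ℝ → ℝ} {a : ℝ}
    (hw : ∀ t ≤ a, HasDerivAt w (w' t) t) (hlim : Tendsto w atBot (nhds 0))
    (hneg : ∀ t ≤ a, 0 < w t → w' t < 0) : w a ≤ 0 := by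
  by_contra! hpos
  have key : ∀ s : ℝ, 0 ≤ s → w a ≤ w (a - s) := by
    intro s hs
    have hd : ∀ x, 0 ≤ x → HasDerivAt (fun x ↦ w (a - x)) (-(w' (a - x))) x := fun x hx ↦ by
      simpa using (hw (a - x) (by linarith)).comp_const_sub a x
    refine image_le_of_deriv_right_lt_deriv_boundary' (f := fun _ ↦ w a) (f' := fun _ ↦ 0)
      (B := fun x ↦ w (a - x)) (B' := fun x ↦ -(w' (a - x))) (a := 0) (b := s)
      continuousOn_const (fun x _ ↦ hasDerivWithinAt_const _ _ _) (by simp)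
      (fun x hx ↦ (hd x hx.1).continuousAt.continuousWithinAt)
      (fun x hx ↦ (hd x hx.1).hasDerivWithinAt) ?_ ⟨hs, le_rfl⟩
    intro x hx hxe
    have := hneg (a - x) (by linarith [hx.1]) (by rw [← hxe]; exact hpos)
    linarith
  have : w a ≤ 0 := by
    refine ge_of_tendsto hlim ?_
    filter_upwards [eventually_le_atBot a] with t ht
    have := key (a - t) (by linarith)
    simpa using this
  linarith

/-- A barrier on an interval: `w` cannot become positive if it decreases wherever it vanishes. -/
lemma nonpos_of_deriv_neg_at_zeros {w w' : ℝ → ℝ} {a b : ℝ}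
    (hw : ∀ t, HasDerivAt w (w' t) t) (ha : w a ≤ 0)
    (hneg : ∀ t ∈ Ico a b, w t = 0 → w' t < 0) : ∀ t ∈ Icc a b, w t ≤ 0 :=
  image_le_of_deriv_right_lt_deriv_boundary' (B := fun _ ↦ 0) (B' := fun _ ↦ 0)
    (fun x _ ↦ (hw x).continuousAt.continuousWithinAt) (fun x _ ↦ (hw x).hasDerivWithinAt) ha
    continuousOn_const (fun _ _ ↦ hasDerivWithinAt_const _ _ _) hneg

/-- Backward continuous dependence on initial data for Lipschitz autonomous equations. -/
lemma dist_le_of_trajectories_backward {E : Type*} [NormedAddCommGroup E] [NormedSpace ℝ E]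
    {v : E → E} {K : NNReal} (hK : LipschitzWith K v) {f g : ℝ → E}
    (hf : ∀ t, HasDerivAt f (v (f t)) t) (hg : ∀ t, HasDerivAt g (v (g t)) t) {t : ℝ}
    (ht : t ≤ 0) : dist (f t) (g t) ≤ dist (f 0) (g 0) * exp (K * (-t)) := by
  have hrev : ∀ h : ℝ → E, (∀ t, HasDerivAt h (v (h t)) t) →
      ∀ t, HasDerivAt (fun s ↦ h (-s)) (-(v (h (-t)))) t := fun h hh t ↦ by
    have := (hh (-t)).scomp t (hasDerivAt_neg t)
    simpa [Function.comp_def] using this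
  have := dist_le_of_trajectories_ODE (v := fun _ x ↦ -(v x)) (K := K) (a := 0) (b := -t)
    (f := fun s ↦ f (-s)) (g := fun s ↦ g (-s)) (δ := dist (f 0) (g 0)) (fun _ ↦ hK.neg)
    (fun x _ ↦ (hrev f hf x).continuousAt.continuousWithinAt)
    (fun x _ ↦ (hrev f hf x).hasDerivWithinAt)
    (fun x _ ↦ (hrev g hg x).continuousAt.continuousWithinAt)
    (fun x _ ↦ (hrev g hg x).hasDerivWithinAt) (by simp) (-t) ⟨by linarith, le_rfl⟩
  simpa using this

/-- Global solutions of the scalar field system. -/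
def IsFieldSolution (T θ : ℝ → ℝ) : Prop :=
  ∀ τ : ℝ, HasDerivAt T (3 * T τ * (1 - T τ)^2 * (Real.sin (θ τ))^2) τ ∧
    HasDerivAt θ (-(T τ) - (3/2) * (1 - T τ) * Real.sin (2 * θ τ)) τ

/-- The vector field of the system, with `T` clamped to `[0, 1]`. -/
noncomputable def clampedField (p : ℝ × ℝ) : ℝ × ℝ :=
  (3 * max 0 (min 1 p.1) * (1 - max 0 (min 1 p.1))^2 * (Real.sin p.2)^2,
    -(max 0 (min 1 p.1)) - (3/2) * (1 - max 0 (min 1 p.1)) * Real.sin (2 * p.2))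

lemma clamp_mem_Icc (x : ℝ) : max 0 (min 1 x) ∈ Icc (0 : ℝ) 1 :=
  ⟨le_max_left _ _, max_le zero_le_one (min_le_left _ _)⟩

lemma clamp_eq_self {x : ℝ} (hx : x ∈ Icc (0 : ℝ) 1) : max 0 (min 1 x) = x := by
  rw [min_eq_right hx.2, max_eq_right hx.1]

lemma abs_clamp_sub_le (x y : ℝ) : |max 0 (min 1 x) - max 0 (min 1 y)| ≤ |x - y| := by
  have h1 := abs_max_sub_max_le_abs (min 1 x) (min 1 y) 0
  have h2 := abs_inf_sub_inf_le_abs x y 1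
  rw [max_comm 0, max_comm 0]
  rw [inf_comm x, inf_comm y] at h2
  exact h1.trans h2

lemma abs_cubic_mul_sub_le {a b u w : ℝ} (ha : a ∈ Icc (0 : ℝ) 1) (hb : b ∈ Icc (0 : ℝ) 1)
    (hu : |u| ≤ 1) :
    |3 * a * (1 - a)^2 * u - 3 * b * (1 - b)^2 * w| ≤ 9 * |a - b| + 3 * |u - w| := by
  obtain ⟨a0, a1⟩ := ha
  obtain ⟨b0, b1⟩ := hb
  have e : 3 * a * (1 - a)^2 * u - 3 * b * (1 - b)^2 * w =
      (3 * (1 - 2 * (a + b) + (a^2 + a * b + b^2)) * u) * (a - b)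
        + (3 * b * (1 - b)^2) * (u - w) := by ring
  have h1 : |3 * (1 - 2 * (a + b) + (a^2 + a * b + b^2)) * u| ≤ 9 := by
    rw [abs_mul]
    have : |3 * (1 - 2 * (a + b) + (a^2 + a * b + b^2))| ≤ 9 := by
      rw [abs_le]; constructor <;> nlinarith [mul_nonneg a0 b0, mul_nonneg a0 (sub_nonneg.2 a1),
        mul_nonneg b0 (sub_nonneg.2 b1), mul_nonneg (sub_nonneg.2 a1) (sub_nonneg.2 b1)]
    nlinarith [abs_nonneg u]
  have h2 : |3 * b * (1 - b)^2| ≤ 3 := by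
    have hs : (1 - b)^2 ≤ 1 := by nlinarith
    rw [abs_of_nonneg (by positivity)]
    nlinarith [sq_nonneg (1 - b)]
  rw [e]
  refine (abs_add_le _ _).trans ?_
  rw [abs_mul, abs_mul (3 * b * (1 - b)^2)]
  gcongr

lemma abs_affine_mul_sub_le {a b u w : ℝ} (ha : a ∈ Icc (0 : ℝ) 1) (hb : b ∈ Icc (0 : ℝ) 1)
    (hu : |u| ≤ 1) :
    |(-a - (3/2) * (1 - a) * u) - (-b - (3/2) * (1 - b) * w)| ≤ 3 * |a - b| + 2 * |u - w| := by
  obtain ⟨a0, a1⟩ := ha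
  obtain ⟨b0, b1⟩ := hb
  have e : (-a - (3/2) * (1 - a) * u) - (-b - (3/2) * (1 - b) * w) =
      (-1 + 3/2 * u) * (a - b) + (-(3/2) * (1 - b)) * (u - w) := by ring
  have h1 : |-1 + 3/2 * u| ≤ 3 := by
    have := abs_le.1 hu
    rw [abs_le]; constructor <;> linarith [this.1, this.2]
  have h2 : |-(3/2) * (1 - b)| ≤ 2 := by
    rw [abs_le]; constructor <;> linarith
  rw [e]
  refine (abs_add_le _ _).trans ?_
  rw [abs_mul, abs_mul (-(3/2) * (1 - b))]
  gcongr

lemma abs_sin_sq_le_one (x : ℝ) : |sin x ^ 2| ≤ 1 := by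
  rw [abs_of_nonneg (sq_nonneg _)]; exact sin_sq_le_one x

lemma abs_sin_sq_sub_le (a b : ℝ) : |sin a ^ 2 - sin b ^ 2| ≤ 2 * |a - b| := by
  rw [sq_sub_sq, abs_mul]
  have h : |sin a + sin b| ≤ 2 :=
    (abs_add_le _ _).trans (by linarith [abs_sin_le_one a, abs_sin_le_one b])
  have := abs_sin_sub_sin_le a b
  gcongr

lemma lipschitzWith_clampedField : LipschitzWith 15 clampedField := by
  refine LipschitzWith.of_dist_le_mul fun p q ↦ ?_
  have hc := abs_clamp_sub_le p.1 q.1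
  have hp := clamp_mem_Icc p.1
  have hq := clamp_mem_Icc q.1
  have hd0 : 0 ≤ dist p q := dist_nonneg
  have hd1 : |p.1 - q.1| ≤ dist p q := le_max_left _ _
  have hd2 : |p.2 - q.2| ≤ dist p q := le_max_right _ _
  have h1 := abs_cubic_mul_sub_le hp hq (w := sin q.2 ^ 2) (abs_sin_sq_le_one p.2)
  have h2 := abs_affine_mul_sub_le (w := sin (2 * q.2)) hp hq (abs_sin_le_one (2 * p.2))
  have h3 := abs_sin_sq_sub_le p.2 q.2
  have h4 := abs_sin_sub_sin_le (2 * p.2) (2 * q.2)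
  rw [← mul_sub, abs_mul, abs_two] at h4
  rw [Prod.dist_eq (x := clampedField p), Real.dist_eq, Real.dist_eq]
  simp only [clampedField, NNReal.coe_ofNat]
  exact max_le (by linarith) (by linarith)

lemma norm_clampedField_le (p : ℝ × ℝ) : ‖clampedField p‖ ≤ (15 : NNReal) := by
  have hp := clamp_mem_Icc p.1
  have h0 : (0 : ℝ) ∈ Icc (0 : ℝ) 1 := by simp
  have h1 := abs_cubic_mul_sub_le hp h0 (abs_sin_sq_le_one p.2) (w := 0)
  have h2 := abs_affine_mul_sub_le (w := 0) hp h0 (abs_sin_le_one (2 * p.2))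
  have h3 := abs_sin_sq_le_one p.2
  have h4 := abs_sin_le_one (2 * p.2)
  have h5 : |max 0 (min 1 p.1)| ≤ 1 := by rw [abs_of_nonneg hp.1]; exact hp.2
  rw [Prod.norm_def, Real.norm_eq_abs, Real.norm_eq_abs]
  simp only [sub_zero, mul_zero, zero_mul, neg_zero] at h1 h2
  simp only [clampedField, NNReal.coe_ofNat]
  exact max_le (by linarith) (by linarith)

/-- A solution of the clamped equation which starts with `T ∈ (0, 1)` keeps `T ∈ (0, 1)`. -/
lemma mem_Ioo_of_clampedField {γ : ℝ → ℝ × ℝ} (hγ : ∀ t, HasDerivAt γ (clampedField (γ t)) t)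
    (h0 : (γ 0).1 ∈ Ioo (0 : ℝ) 1) (t : ℝ) : (γ t).1 ∈ Ioo (0 : ℝ) 1 := by
  let v : ℝ → ℝ → ℝ := fun t x ↦
    3 * max 0 (min 1 x) * (1 - max 0 (min 1 x))^2 * (Real.sin (γ t).2)^2
  have hv : ∀ t, LipschitzOnWith 9 (v t) univ := fun t ↦ by
    refine (LipschitzWith.of_dist_le_mul fun x y ↦ ?_).lipschitzOnWith
    have h1 := abs_cubic_mul_sub_le (clamp_mem_Icc x) (clamp_mem_Icc y)
      (w := sin (γ t).2 ^ 2)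
      (abs_sin_sq_le_one (γ t).2)
    have h2 := abs_clamp_sub_le x y
    rw [sub_self, abs_zero] at h1
    rw [Real.dist_eq, Real.dist_eq]
    simp only [v, NNReal.coe_ofNat]
    linarith
  have hT : ∀ t, HasDerivAt (fun t ↦ (γ t).1) (v t (γ t).1) t := fun t ↦
    (hγ t).fst
  have hne : ∀ c : ℝ, (∀ t, v t c = 0) → (γ 0).1 ≠ c → ∀ s, (γ s).1 ≠ c := by
    intro c hc hc0 s hs
    have := ODE_solution_unique_univ (f := fun t ↦ (γ t).1) (g := fun _ ↦ c) (t₀ := s) hv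
      (fun t ↦ ⟨hT t, trivial⟩) (fun t ↦ ⟨by rw [hc]; exact hasDerivAt_const _ _, trivial⟩) hs
    exact hc0 (congrFun this 0)
  have hcont : Continuous fun t ↦ (γ t).1 :=
    continuous_iff_continuousAt.2 fun t ↦ (hT t).continuousAt
  have h0' := hne 0 (fun t ↦ by simp [v]) h0.1.ne'
  have h1' := hne 1 (fun t ↦ by simp [v]) h0.2.ne
  have hpre : IsPreconnected (range fun t ↦ (γ t).1) := isPreconnected_range hcont
  constructor
  · by_contra! h
    obtain ⟨s, hs⟩ := hpre.ordConnected.out ⟨t, rfl⟩ ⟨0, rfl⟩ ⟨h, h0.1.le⟩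
    exact h0' s hs
  · by_contra! h
    obtain ⟨s, hs⟩ := hpre.ordConnected.out ⟨0, rfl⟩ ⟨t, rfl⟩ ⟨h0.2.le, h⟩
    exact h1' s hs

lemma IsFieldSolution.hasDerivAt_clampedField {T θ : ℝ → ℝ} (h : IsFieldSolution T θ)
    (hT : ∀ τ, T τ ∈ Ioo (0 : ℝ) 1) (t : ℝ) :
    HasDerivAt (fun τ ↦ (T τ, θ τ)) (clampedField (T t, θ t)) t := by
  have := (h t).1.prodMk (h t).2
  simpa only [clampedField, clamp_eq_self (Ioo_subset_Icc_self (hT t))] using this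

lemma exists_isFieldSolution {a : ℝ} (ha : a ∈ Ioo (0 : ℝ) 1) (b : ℝ) :
    ∃ T θ : ℝ → ℝ, T 0 = a ∧ θ 0 = b ∧ IsFieldSolution T θ ∧ ∀ τ, T τ ∈ Ioo (0 : ℝ) 1 := by
  obtain ⟨γ, h0, hγ⟩ := exists_global_solution_of_lipschitz_bounded lipschitzWith_clampedField
    norm_clampedField_le (a, b)
  have hmem := mem_Ioo_of_clampedField hγ (by rw [h0]; exact ha)
  refine ⟨fun t ↦ (γ t).1, fun t ↦ (γ t).2, by simp [h0], by simp [h0], fun t ↦ ?_, hmem⟩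
  have hc := clamp_eq_self (Ioo_subset_Icc_self (hmem t))
  have h1 : HasDerivAt (fun t ↦ (γ t).1) (clampedField (γ t)).1 t :=
    (hγ t).fst
  have h2 : HasDerivAt (fun t ↦ (γ t).2) (clampedField (γ t)).2 t :=
    (hγ t).snd
  simp only [clampedField, hc] at h1 h2
  exact ⟨h1, h2⟩

lemma IsFieldSolution.comp_add_const {T θ : ℝ → ℝ} (h : IsFieldSolution T θ) (c : ℝ) :
    IsFieldSolution (fun τ ↦ T (τ + c)) (fun τ ↦ θ (τ + c)) := fun τ ↦
  ⟨(h (τ + c)).1.comp_add_const τ c, (h (τ + c)).2.comp_add_const τ c⟩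

lemma IsFieldSolution.eq_of_eq_at {T₁ θ₁ T₂ θ₂ : ℝ → ℝ} (h₁ : IsFieldSolution T₁ θ₁)
    (hT₁ : ∀ τ, T₁ τ ∈ Ioo (0 : ℝ) 1) (h₂ : IsFieldSolution T₂ θ₂)
    (hT₂ : ∀ τ, T₂ τ ∈ Ioo (0 : ℝ) 1) {t : ℝ} (hT : T₁ t = T₂ t) (hθ : θ₁ t = θ₂ t) :
    T₁ = T₂ ∧ θ₁ = θ₂ := by
  have := ODE_solution_unique_univ (v := fun _ ↦ clampedField) (s := fun _ ↦ univ) (t₀ := t)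
    (fun _ ↦ lipschitzWith_clampedField.lipschitzOnWith)
    (fun t ↦ ⟨h₁.hasDerivAt_clampedField hT₁ t, trivial⟩)
    (fun t ↦ ⟨h₂.hasDerivAt_clampedField hT₂ t, trivial⟩) (by rw [hT, hθ])
  exact ⟨funext fun s ↦ (Prod.ext_iff.1 (congrFun this s)).1,
    funext fun s ↦ (Prod.ext_iff.1 (congrFun this s)).2⟩

lemma IsFieldSolution.monotone {T θ : ℝ → ℝ} (h : IsFieldSolution T θ)
    (hT : ∀ τ, T τ ∈ Ioo (0 : ℝ) 1) : Monotone T :=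
  monotone_of_hasDerivAt_nonneg (fun t ↦ (h t).1) fun t ↦ by
    have := (hT t).1
    simp only [Pi.zero_apply]
    positivity

/-- `θ` moves down relative to the line `θ = -T / 4` on and above it. -/
lemma deriv_upper_neg {T θ : ℝ} (hT : 0 < T) (hT' : T ≤ 1/4) (hθ' : θ ≤ 1/4)
    (hθ : -T/4 ≤ θ) :
    (-T - (3/2) * (1 - T) * sin (2 * θ)) + (3 * T * (1 - T)^2 * (sin θ)^2) / 4 < 0 := by
  have hs : (1 - T)^2 * sin θ ^ 2 ≤ 1/16 := by
    have h1 : (1 - T)^2 ≤ 1 := by nlinarith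
    have h2 : sin θ ^ 2 ≤ 1/16 := by
      have : |sin θ| ≤ 1/4 := abs_sin_le_abs.trans (abs_le.2 ⟨by linarith, hθ'⟩)
      rw [← sq_abs]; nlinarith [abs_nonneg (sin θ)]
    nlinarith [sq_nonneg (sin θ), sq_nonneg (1 - T)]
  have hsin : -(T/2) ≤ sin (2 * θ) := by
    rcases le_or_gt 0 θ with h | h
    · have := sin_nonneg_of_nonneg_of_le_pi (x := 2 * θ) (by linarith) (by linarith [pi_gt_three])
      linarith
    · have := sin_le (x := -(2 * θ)) (by linarith)
      rw [sin_neg] at this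
      linarith
  nlinarith [mul_le_mul_of_nonneg_left hs hT.le,
    mul_le_mul_of_nonneg_left hsin (by linarith : (0:ℝ) ≤ 1 - T)]

lemma le_sin_of_le_half {y : ℝ} (h0 : 0 ≤ y) (h : y ≤ 1/2) : 15/16 * y ≤ sin y := by
  rcases h0.eq_or_lt with rfl | h0
  · simp
  · have := sin_gt_sub_cube h0
    nlinarith [mul_pos h0 h0, mul_nonneg h0.le (sub_nonneg.2 h)]

/-- `θ` moves up relative to the line `θ = -T / 2` on and below it. -/
lemma deriv_lower_pos {T θ : ℝ} (hT : 0 < T) (hT' : T ≤ 1/4) (hθ' : -1/4 ≤ θ)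
    (hθ : θ ≤ -T/2) :
    0 < (-T - (3/2) * (1 - T) * sin (2 * θ)) + (3 * T * (1 - T)^2 * (sin θ)^2) / 2 := by
  have h1 := le_sin_of_le_half (y := -(2 * θ)) (by linarith) (by linarith)
  rw [sin_neg] at h1
  have h2 : 0 ≤ 3 * T * (1 - T)^2 * (sin θ)^2 := by positivity
  nlinarith

/-- Inside the wedge `-T / 2 ≤ θ ≤ -T / 4`, `dθ/dT` is decreasing in `θ`. -/
lemma slope_strictAnti {T a b : ℝ} (hT : 0 < T) (hT' : T ≤ 1/4) (hb : -T/2 ≤ b) (hba : b < a)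
    (ha : a ≤ -T/4) :
    (-T - (3/2) * (1 - T) * sin (2 * a)) * sin b ^ 2
      < (-T - (3/2) * (1 - T) * sin (2 * b)) * sin a ^ 2 := by
  obtain ⟨x, rfl⟩ : ∃ x, a = -x := ⟨-a, by ring⟩
  obtain ⟨y, rfl⟩ : ∃ y, b = -y := ⟨-b, by ring⟩
  have hx0 : 0 < sin x := sin_pos_of_pos_of_lt_pi (by linarith) (by linarith [pi_gt_three])
  have hy0 : 0 < sin y := sin_pos_of_pos_of_lt_pi (by linarith) (by linarith [pi_gt_three])
  have hd : 0 < sin (y - x) :=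
    sin_pos_of_pos_of_lt_pi (by linarith) (by linarith [pi_gt_three])
  have hx1 : sin x ≤ T/2 := (sin_le (by linarith)).trans (by linarith)
  have hy1 : sin y ≤ T/2 := (sin_le (by linarith)).trans (by linarith)
  have hcx : 7/8 ≤ cos x := by
    have := one_sub_sq_div_two_le_cos (x := x); nlinarith
  have hcy : 7/8 ≤ cos y := by
    have := one_sub_sq_div_two_le_cos (x := y); nlinarith
  have key : 3 * (1 - T) * (sin x * sin y) < T * (sin x * cos y + sin y * cos x) := by
    have hxy := mul_pos hx0 hy0
    nlinarith [mul_le_mul_of_nonneg_left hx1 hy0.le, mul_le_mul_of_nonneg_left hy1 hx0.le,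
      mul_le_mul_of_nonneg_left hcx (mul_pos hT hy0).le,
      mul_le_mul_of_nonneg_left hcy (mul_pos hT hx0).le, mul_pos hT hx0, mul_pos hT hy0,
      mul_pos hT hxy]
  have e : (-T - (3/2) * (1 - T) * sin (2 * -x)) * sin (-y) ^ 2
      - (-T - (3/2) * (1 - T) * sin (2 * -y)) * sin (-x) ^ 2
      = sin (y - x) * (3 * (1 - T) * (sin x * sin y) - T * (sin x * cos y + sin y * cos x)) := by
    rw [mul_neg, mul_neg, sin_neg, sin_neg, sin_neg, sin_neg, sin_two_mul, sin_two_mul, sin_sub]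
    linear_combination T * (sin y ^ 2 * sin_sq_add_cos_sq x - sin x ^ 2 * sin_sq_add_cos_sq y)
  have := mul_pos hd (sub_pos.2 key)
  linarith

/-- The wedge containing the unstable center manifold of the de Sitter point near `(0, 0)`. -/
def deSitterWedge : Set (ℝ × ℝ) :=
  {p | p.1 ≤ 1/4 ∧ -p.1/2 ≤ p.2 ∧ p.2 ≤ -p.1/4}

lemma isClosed_deSitterWedge : IsClosed deSitterWedge :=
  (isClosed_le continuous_fst continuous_const).inter
    ((isClosed_le (continuous_fst.neg.div_const 2) continuous_snd).inter
      (isClosed_le continuous_snd (continuous_fst.neg.div_const 4)))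

lemma sin_neg_of_mem_deSitterWedge {x y : ℝ} (hx : 0 < x) (h : (x, y) ∈ deSitterWedge) :
    sin y < 0 := by
  obtain ⟨h1, h2, h3⟩ := h
  simp only at h1 h2 h3
  exact sin_neg_of_neg_of_neg_pi_lt (by linarith) (by linarith [pi_gt_three])

lemma IsFieldSolution.hasDerivAt_add_mul {T θ : ℝ → ℝ} (h : IsFieldSolution T θ) (k t : ℝ) :
    HasDerivAt (fun τ ↦ θ τ + T τ / k)
      ((-(T t) - (3/2) * (1 - T t) * Real.sin (2 * θ t))
        + (3 * T t * (1 - T t)^2 * (Real.sin (θ t))^2) / k) t :=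
  (h t).2.add ((h t).1.div_const k)

lemma IsFieldSolution.exists_forall_le_mem_deSitterWedge {T θ : ℝ → ℝ}
    (h : IsFieldSolution T θ) (hT : ∀ τ, T τ ∈ Ioo (0 : ℝ) 1)
    (hlim : Tendsto (fun τ ↦ (T τ, θ τ)) atBot (nhds ((0 : ℝ), (0 : ℝ)))) :
    ∃ a, ∀ t ≤ a, (T t, θ t) ∈ deSitterWedge := by
  have hT0 : Tendsto T atBot (nhds 0) := (continuous_fst.tendsto _).comp hlim
  have hθ0 : Tendsto θ atBot (nhds 0) := (continuous_snd.tendsto _).comp hlim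
  have hk : ∀ k : ℝ, Tendsto (fun τ ↦ θ τ + T τ / k) atBot (nhds 0) := fun k ↦ by
    simpa using hθ0.add (hT0.div_const k)
  obtain ⟨a, ha⟩ := eventually_atBot.1 ((hT0.eventually_le_const (by norm_num : (0:ℝ) < 1/4)).and
    ((hθ0.eventually_le_const (by norm_num : (0:ℝ) < 1/4)).and
      (hθ0.eventually_const_le (by norm_num : (-1/4:ℝ) < 0))))
  refine ⟨a, fun t ht ↦ ⟨(ha t ht).1, ?_, ?_⟩⟩
  · have := nonpos_of_tendsto_zero_atBot_of_deriv_neg (w := fun τ ↦ -(θ τ + T τ / 2)) (a := t)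
      (fun s _ ↦ (h.hasDerivAt_add_mul 2 s).neg) (by simpa using (hk 2).neg) (fun s hs hpos ↦ by
        obtain ⟨h1, h2, h3⟩ := ha s (hs.trans ht)
        have := deriv_lower_pos (hT s).1 h1 h3 (by linarith)
        linarith)
    simp only at this ⊢
    linarith
  · have := nonpos_of_tendsto_zero_atBot_of_deriv_neg (w := fun τ ↦ θ τ + T τ / 4) (a := t)
      (fun s _ ↦ h.hasDerivAt_add_mul 4 s) (hk 4) (fun s hs hpos ↦ by
        obtain ⟨h1, h2, h3⟩ := ha s (hs.trans ht)
        exact deriv_upper_neg (hT s).1 h1 h2 (by linarith))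
    simp only at this ⊢
    linarith

lemma IsFieldSolution.eq_translate_of_tendsto {T₁ θ₁ T₂ θ₂ : ℝ → ℝ}
    (h₁ : IsFieldSolution T₁ θ₁) (hT₁ : ∀ τ, T₁ τ ∈ Ioo (0 : ℝ) 1)
    (hlim₁ : Tendsto (fun τ ↦ (T₁ τ, θ₁ τ)) atBot (nhds ((0 : ℝ), (0 : ℝ))))
    (h₂ : IsFieldSolution T₂ θ₂) (hT₂ : ∀ τ, T₂ τ ∈ Ioo (0 : ℝ) 1)
    (hlim₂ : Tendsto (fun τ ↦ (T₂ τ, θ₂ τ)) atBot (nhds ((0 : ℝ), (0 : ℝ)))) :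
    ∃ c : ℝ, ∀ τ : ℝ, T₂ τ = T₁ (τ + c) ∧ θ₂ τ = θ₁ (τ + c) := by
  have hT₁0 : Tendsto T₁ atBot (nhds 0) := (continuous_fst.tendsto _).comp hlim₁
  have hT₂0 : Tendsto T₂ atBot (nhds 0) := (continuous_fst.tendsto _).comp hlim₂
  have hθ₂0 : Tendsto θ₂ atBot (nhds 0) := (continuous_snd.tendsto _).comp hlim₂
  obtain ⟨a, ha⟩ := h₁.exists_forall_le_mem_deSitterWedge hT₁ hlim₁
  obtain ⟨b₀, hb₀⟩ := h₂.exists_forall_le_mem_deSitterWedge hT₂ hlim₂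
  obtain ⟨b, hb⟩ := eventually_atBot.1 ((hT₂0.eventually_lt_const (hT₁ a).1).and
    (eventually_le_atBot b₀))
  have hpos : ∀ t ≤ a, 0 < 3 * T₁ t * (1 - T₁ t)^2 * (sin (θ₁ t))^2 := fun t ht ↦ by
    have h1 := (hT₁ t).1
    have h2 := sub_pos.2 (hT₁ t).2
    have h3 := (sin_neg_of_mem_deSitterWedge h1 (ha t ht)).ne
    positivity
  have hcont : Continuous T₁ := continuous_iff_continuousAt.2 fun t ↦ (h₁ t).1.continuousAt
  have hcontθ : Continuous θ₁ := continuous_iff_continuousAt.2 fun t ↦ (h₁ t).2.continuousAt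
  have hmono : StrictMonoOn T₁ (Iic a) :=
    strictMonoOn_of_deriv_pos (convex_Iic a) hcont.continuousOn fun t ht ↦ by
      rw [(h₁ t).1.deriv]
      exact hpos t (interior_subset (s := Iic a) ht)
  have hinj : InjOn T₁ (Iio a) := (hmono.mono Iio_subset_Iic_self).injOn
  set σ : ℝ → ℝ := fun τ ↦ Function.invFunOn T₁ (Iio a) (T₂ τ) with hσ
  have hσmem : ∀ τ ≤ b, σ τ < a ∧ T₁ (σ τ) = T₂ τ := by
    intro τ hτ
    have hex : ∃ s ∈ Iio a, T₁ s = T₂ τ := by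
      obtain ⟨m, hm, hma⟩ := ((hT₁0.eventually_lt_const (hT₂ τ).1).and
        (eventually_le_atBot a)).exists
      obtain ⟨s, hs, hse⟩ := intermediate_value_Ico hma hcont.continuousOn ⟨hm.le, (hb τ hτ).1⟩
      exact ⟨s, hs.2, hse⟩
    exact ⟨Function.invFunOn_mem hex, Function.invFunOn_eq hex⟩
  have hσderiv : ∀ τ ≤ b, HasDerivAt σ
      ((3 * T₁ (σ τ) * (1 - T₁ (σ τ))^2 * (sin (θ₁ (σ τ)))^2)⁻¹
        * (3 * T₂ τ * (1 - T₂ τ)^2 * (sin (θ₂ τ))^2)) τ := by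
    intro τ hτ
    obtain ⟨hlt, heq⟩ := hσmem τ hτ
    have hstrict : HasStrictDerivAt T₁
        (3 * T₁ (σ τ) * (1 - T₁ (σ τ))^2 * (sin (θ₁ (σ τ)))^2) (σ τ) :=
      hasStrictDerivAt_of_hasDerivAt_of_continuousAt (Eventually.of_forall fun t ↦ (h₁ t).1)
        (by fun_prop)
    have hinv := hstrict.to_local_left_inverse (g := Function.invFunOn T₁ (Iio a))
      (hpos _ hlt.le).ne' (by
        filter_upwards [Iio_mem_nhds hlt] with x hx
        exact hinj.leftInvOn_invFunOn hx)
    rw [heq] at hinv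
    rw [heq]
    exact hinv.hasDerivAt.comp τ (h₂ τ).1
  obtain ⟨w', hw'⟩ : ∃ w' : ℝ → ℝ, ∀ τ, w' τ = (-(T₂ τ) - (3/2) * (1 - T₂ τ) * sin (2 * θ₂ τ))
    - (-(T₂ τ) - (3/2) * (1 - T₂ τ) * sin (2 * θ₁ (σ τ)))
      * ((sin (θ₁ (σ τ)) ^ 2)⁻¹ * sin (θ₂ τ) ^ 2) := ⟨_, fun _ ↦ rfl⟩
  have hw : ∀ τ ≤ b, HasDerivAt (fun τ ↦ θ₂ τ - θ₁ (σ τ)) (w' τ) τ := by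
    intro τ hτ
    have heq := (hσmem τ hτ).2
    have hd := (h₂ τ).2.sub ((h₁ (σ τ)).2.comp τ (hσderiv τ hτ))
    refine hd.congr_deriv ?_
    have h1 := (hT₂ τ).1.ne'
    have h2 := (sub_pos.2 (hT₂ τ).2).ne'
    rw [hw', heq]
    field_simp
  have hwedge₁ : ∀ τ ≤ b, (T₂ τ, θ₁ (σ τ)) ∈ deSitterWedge := fun τ hτ ↦ by
    have := ha _ (hσmem τ hτ).1.le
    rwa [(hσmem τ hτ).2] at this
  have hwedge₂ : ∀ τ ≤ b, (T₂ τ, θ₂ τ) ∈ deSitterWedge := fun τ hτ ↦ hb₀ τ (hb τ hτ).2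
  have hθσ : Tendsto (fun τ ↦ θ₁ (σ τ)) atBot (nhds 0) := by
    refine squeeze_zero_norm' (a := T₂) ?_ hT₂0
    filter_upwards [eventually_le_atBot b] with τ hτ
    obtain ⟨-, h2, h3⟩ := hwedge₁ τ hτ
    have := (hT₂ τ).1
    simp only at h2 h3
    rw [Real.norm_eq_abs, abs_le]
    constructor <;> linarith
  have hwlim : Tendsto (fun τ ↦ θ₂ τ - θ₁ (σ τ)) atBot (nhds 0) := by
    simpa using hθ₂0.sub hθσ
  have hw'eq : ∀ τ ≤ b, w' τ * sin (θ₁ (σ τ)) ^ 2 =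
      (-(T₂ τ) - (3/2) * (1 - T₂ τ) * sin (2 * θ₂ τ)) * sin (θ₁ (σ τ)) ^ 2
      - (-(T₂ τ) - (3/2) * (1 - T₂ τ) * sin (2 * θ₁ (σ τ))) * sin (θ₂ τ) ^ 2 := by
    intro τ hτ
    have := (sin_neg_of_mem_deSitterWedge (hT₂ τ).1 (hwedge₁ τ hτ)).ne
    rw [hw']
    field_simp
  have hle : θ₂ b - θ₁ (σ b) ≤ 0 :=
    nonpos_of_tendsto_zero_atBot_of_deriv_neg (w := fun τ ↦ θ₂ τ - θ₁ (σ τ)) hw hwlim fun τ hτ hp ↦ by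
      have hlt := slope_strictAnti (hT₂ τ).1 (hwedge₁ τ hτ).1 (hwedge₁ τ hτ).2.1
        (sub_pos.1 hp) (hwedge₂ τ hτ).2.2
      have he := hw'eq τ hτ
      by_contra! hn
      have := mul_nonneg hn (sq_nonneg (sin (θ₁ (σ τ))))
      linarith
  have hge : -(θ₂ b - θ₁ (σ b)) ≤ 0 :=
    nonpos_of_tendsto_zero_atBot_of_deriv_neg (w := fun τ ↦ -(θ₂ τ - θ₁ (σ τ)))
      (fun τ hτ ↦ (hw τ hτ).neg) (by simpa using hwlim.neg) fun τ hτ hp ↦ by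
      have hlt := slope_strictAnti (hT₂ τ).1 (hwedge₁ τ hτ).1 (hwedge₂ τ hτ).2.1
        (by linarith : θ₂ τ < θ₁ (σ τ)) (hwedge₁ τ hτ).2.2
      have he := hw'eq τ hτ
      by_contra! hn
      have := mul_nonneg hn (sq_nonneg (sin (θ₁ (σ τ))))
      linarith
  obtain ⟨hTe, hθe⟩ := h₂.eq_of_eq_at hT₂ (h₁.comp_add_const (σ b - b)) (fun τ ↦ hT₁ _) (t := b)
    (by simpa using (hσmem b le_rfl).2.symm) (by simp only [add_sub_cancel]; linarith)
  exact ⟨σ b - b, fun τ ↦ ⟨congrFun hTe τ, congrFun hθe τ⟩⟩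

/-- Linear growth of `T` inside the wedge, away from `T = 0`. -/
lemma IsFieldSolution.mul_sub_le_of_mem_deSitterWedge {T θ : ℝ → ℝ} (h : IsFieldSolution T θ)
    (hT : ∀ τ, T τ ∈ Ioo (0 : ℝ) 1) {ε a b : ℝ} (hε : 0 < ε) (hab : a ≤ b) (ha : ε ≤ T a)
    (hw : ∀ t ∈ Icc a b, (T t, θ t) ∈ deSitterWedge) :
    ε ^ 3 / 100 * (b - a) ≤ T b - T a := by
  refine (convex_Icc a b).mul_sub_le_image_sub_of_le_deriv
    (fun t _ ↦ (h t).1.continuousAt.continuousWithinAt)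
    (fun t _ ↦ (h t).1.differentiableAt.differentiableWithinAt) (fun t ht ↦ ?_)
    a ⟨le_rfl, hab⟩ b ⟨hab, le_rfl⟩ hab
  have ht' := interior_subset ht
  obtain ⟨h1, h2, h3⟩ := hw t ht'
  simp only at h1 h2 h3
  have hεT : ε ≤ T t := ha.trans (h.monotone hT ht'.1)
  have hs := le_sin_of_le_half (y := -θ t) (by linarith) (by linarith)
  rw [sin_neg] at hs
  have hsq : (15/64 * ε)^2 ≤ sin (θ t) ^ 2 := by
    rw [← neg_sq (sin (θ t))]
    exact pow_le_pow_left₀ (by positivity) (by linarith) 2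
  have hTt := (hT t).1
  have hc : (3/4)^2 ≤ (1 - T t)^2 := pow_le_pow_left₀ (by norm_num) (by linarith) 2
  rw [(h t).1.deriv]
  calc ε ^ 3 / 100 ≤ 3 * ε * (3/4)^2 * (15/64 * ε)^2 := by nlinarith [pow_pos hε 3]
    _ ≤ _ := by gcongr

lemma IsFieldSolution.le_mul_exp {T θ : ℝ → ℝ} (h : IsFieldSolution T θ)
    (hT : ∀ τ, T τ ∈ Ioo (0 : ℝ) 1) {t : ℝ} (ht : 0 ≤ t) : T t ≤ T 0 * exp (3 * t) := by
  have hd : ∀ s, HasDerivAt (fun s ↦ T s * exp (-(3 * s)))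
      (3 * T s * (1 - T s)^2 * (sin (θ s))^2 * exp (-(3 * s))
        + T s * (exp (-(3 * s)) * (-(3 * 1)))) s := fun s ↦
    (h s).1.mul (((hasDerivAt_id s).const_mul 3).neg.exp)
  have hanti := antitone_of_hasDerivAt_nonpos hd fun s ↦ by
    have h1 := hT s
    have h2 : (1 - T s)^2 * sin (θ s) ^ 2 ≤ 1 :=
      mul_le_one₀ (by nlinarith [h1.1, h1.2]) (sq_nonneg _) (sin_sq_le_one _)
    have h3 : 0 ≤ 3 * T s * exp (-(3 * s)) := by have := h1.1; positivity
    simp only [Pi.zero_apply]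
    nlinarith [mul_le_mul_of_nonneg_left h2 h3]
  have := hanti ht
  simp only [mul_zero, neg_zero, exp_zero, mul_one] at this
  calc T t = T t * exp (-(3 * t)) * exp (3 * t) := by
        rw [mul_assoc, ← exp_add]; simp
    _ ≤ _ := by gcongr

/-- The wedge is forward invariant as long as `T ≤ 1 / 4`. -/
lemma IsFieldSolution.mem_deSitterWedge_of_le {T θ : ℝ → ℝ} (h : IsFieldSolution T θ)
    (hT : ∀ τ, T τ ∈ Ioo (0 : ℝ) 1) {a b : ℝ} (ha : (T a, θ a) ∈ deSitterWedge)
    (hb : T b ≤ 1/4) : ∀ t ∈ Icc a b, (T t, θ t) ∈ deSitterWedge := by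
  obtain ⟨-, h2, h3⟩ := ha
  simp only at h2 h3
  have hle : ∀ t ≤ b, T t ≤ 1/4 := fun t ht ↦ (h.monotone hT ht).trans hb
  have hu := nonpos_of_deriv_neg_at_zeros (w := fun τ ↦ θ τ + T τ / 4) (a := a) (b := b)
    (fun s ↦ h.hasDerivAt_add_mul 4 s) (by linarith) fun s hs h0 ↦
      deriv_upper_neg (hT s).1 (hle s hs.2.le) (by linarith [(hT s).1]) (by linarith)
  have hl := nonpos_of_deriv_neg_at_zeros (w := fun τ ↦ -(θ τ + T τ / 2)) (a := a) (b := b)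
    (fun s ↦ (h.hasDerivAt_add_mul 2 s).neg) (by linarith) fun s hs h0 ↦ by
      have := deriv_lower_pos (hT s).1 (hle s hs.2.le) (θ := θ s)
        (by linarith [hle s hs.2.le]) (by linarith)
      linarith
  intro t ht
  have h4 := hu t ht
  have h5 := hl t ht
  exact ⟨hle t ht.2, by simp only; linarith, by simp only; linarith⟩

lemma exists_isFieldSolution_mem_deSitterWedge_Icc (n : ℕ) :
    ∃ T θ : ℝ → ℝ, IsFieldSolution T θ ∧ (∀ τ, T τ ∈ Ioo (0 : ℝ) 1) ∧ T 0 = 1/4 ∧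
      ∀ t ∈ Icc (-(n : ℝ)) 0, (T t, θ t) ∈ deSitterWedge := by
  set ε : ℝ := 1/4 * exp (-(3 * n)) with hε
  have hε0 : 0 < ε := by positivity
  have hε1 : ε ≤ 1/4 := by
    have : exp (-(3 * (n : ℝ))) ≤ 1 := exp_le_one_iff.2 (by simp)
    linarith
  obtain ⟨T, θ, hT0, hθ0, h, hT⟩ := exists_isFieldSolution (a := ε) ⟨hε0, by linarith⟩ (-ε/3)
  have h0 : (T 0, θ 0) ∈ deSitterWedge := by
    rw [hT0, hθ0]
    exact ⟨hε1, by simp only; linarith, by simp only; linarith⟩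
  have hcont : Continuous T := continuous_iff_continuousAt.2 fun t ↦ (h t).1.continuousAt
  obtain ⟨t, ht0, ht⟩ : ∃ t, 0 ≤ t ∧ T t = 1/4 := by
    have hr : 0 ≤ 100 / ε ^ 3 := by positivity
    have hbig : 1/4 ≤ T (100 / ε ^ 3) := by
      by_contra! hlt
      have := h.mul_sub_le_of_mem_deSitterWedge hT hε0 hr hT0.ge
        (h.mem_deSitterWedge_of_le hT h0 hlt.le)
      rw [sub_zero, div_mul_div_cancel₀ (by norm_num), div_self (by positivity)] at this
      linarith
    obtain ⟨t, ht, hte⟩ := intermediate_value_Icc hr hcont.continuousOn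
      ⟨hT0.le.trans hε1, hbig⟩
    exact ⟨t, ht.1, hte⟩
  have hnt : (n : ℝ) ≤ t := by
    have := h.le_mul_exp hT ht0
    rw [ht, hT0, hε, mul_assoc, ← exp_add] at this
    have h1 : 1 ≤ exp (-(3 * n) + 3 * t) := by linarith
    have := one_le_exp_iff.1 h1
    linarith
  refine ⟨fun s ↦ T (s + t), fun s ↦ θ (s + t), h.comp_add_const t, fun τ ↦ hT _,
    by simpa using ht, fun s hs ↦ ?_⟩
  exact h.mem_deSitterWedge_of_le hT h0 ht.le _ ⟨by linarith [hs.1], by linarith [hs.2]⟩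

lemma exists_isFieldSolution_mem_deSitterWedge_Iic :
    ∃ T θ : ℝ → ℝ, IsFieldSolution T θ ∧ (∀ τ, T τ ∈ Ioo (0 : ℝ) 1) ∧
      ∀ t ≤ 0, (T t, θ t) ∈ deSitterWedge := by
  choose T θ h hT hT0 hw using exists_isFieldSolution_mem_deSitterWedge_Icc
  have hmem : ∀ n, θ n 0 ∈ Icc (-1/8 : ℝ) (-1/16) := fun n ↦ by
    obtain ⟨-, h2, h3⟩ := hw n 0 ⟨by simp, le_rfl⟩
    simp only [hT0] at h2 h3
    constructor <;> linarith
  obtain ⟨s, -, φ, hφ, hlim⟩ := isCompact_Icc.tendsto_subseq hmem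
  obtain ⟨S, η, hS0, hη0, hsol, hS⟩ := exists_isFieldSolution (a := 1/4) (by norm_num) s
  refine ⟨S, η, hsol, hS, fun t ht ↦ ?_⟩
  have hdist : Tendsto (fun n ↦ dist (T (φ n) t, θ (φ n) t) (S t, η t)) atTop (nhds 0) := by
    have hini : Tendsto (fun n ↦ dist (T (φ n) 0, θ (φ n) 0) (S 0, η 0)) atTop (nhds 0) := by
      rw [← tendsto_iff_dist_tendsto_zero]
      simp only [hT0, hS0, hη0]
      exact tendsto_const_nhds.prodMk_nhds hlim
    refine squeeze_zero (fun _ ↦ dist_nonneg)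
      (fun n ↦ dist_le_of_trajectories_backward lipschitzWith_clampedField
        (fun u ↦ (h (φ n)).hasDerivAt_clampedField (hT (φ n)) u)
        (fun u ↦ hsol.hasDerivAt_clampedField hS u) ht) ?_
    simpa using hini.mul_const (exp ((15 : NNReal) * (-t)))
  refine isClosed_deSitterWedge.mem_of_tendsto (tendsto_iff_dist_tendsto_zero.2 hdist) ?_
  filter_upwards [tendsto_natCast_atTop_atTop.eventually_ge_atTop (-t)] with n hn
  have : (n : ℝ) ≤ φ n := by exact_mod_cast hφ.id_le n
  exact hw (φ n) t ⟨by linarith, ht⟩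

lemma IsFieldSolution.tendsto_of_mem_deSitterWedge {T θ : ℝ → ℝ} (h : IsFieldSolution T θ)
    (hT : ∀ τ, T τ ∈ Ioo (0 : ℝ) 1) (hw : ∀ t ≤ 0, (T t, θ t) ∈ deSitterWedge) :
    Tendsto (fun τ ↦ (T τ, θ τ)) atBot (nhds ((0 : ℝ), (0 : ℝ))) := by
  have hT0 : Tendsto T atBot (nhds 0) := by
    refine tendsto_order.2 ⟨fun c hc ↦ Eventually.of_forall fun t ↦ hc.trans (hT t).1,
      fun ε hε ↦ ?_⟩
    obtain ⟨t, ht⟩ : ∃ t, T t < ε := by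
      by_contra! hge
      have hr : -(100 / ε ^ 3) ≤ 0 := neg_nonpos.2 (by positivity)
      have := h.mul_sub_le_of_mem_deSitterWedge hT hε hr (hge _) fun t ht ↦ hw t ht.2
      rw [zero_sub, neg_neg, div_mul_div_cancel₀ (by norm_num), div_self (by positivity)] at this
      linarith [(hT 0).2, (hT (-(100 / ε ^ 3))).1]
    filter_upwards [eventually_le_atBot t] with s hs
    exact (h.monotone hT hs).trans_lt ht
  refine hT0.prodMk_nhds (squeeze_zero_norm' (a := T) ?_ hT0)
  filter_upwards [eventually_le_atBot 0] with τ hτ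
  obtain ⟨-, h2, h3⟩ := hw τ hτ
  have := (hT τ).1
  simp only at h2 h3
  rw [Real.norm_eq_abs, abs_le]
  constructor <;> linarith

/-- There exists a global interior solution converging to the de Sitter
fixed point (0,0) as τ → −∞ (the attractor solution), and it is unique up to time
translation. -/
theorem stmt_12 :
    (∃ T θ : ℝ → ℝ,
      (∀ τ : ℝ,
        HasDerivAt T (3 * T τ * (1 - T τ)^2 * (Real.sin (θ τ))^2) τ ∧
        HasDerivAt θ (-(T τ) - (3/2) * (1 - T τ) * Real.sin (2 * θ τ)) τ) ∧
      (∀ τ : ℝ, T τ ∈ Set.Ioo (0:ℝ) 1) ∧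
      Tendsto (fun τ => (T τ, θ τ)) atBot (nhds ((0:ℝ), (0:ℝ)))) ∧
    (∀ T₁ θ₁ T₂ θ₂ : ℝ → ℝ,
      ((∀ τ : ℝ,
        HasDerivAt T₁ (3 * T₁ τ * (1 - T₁ τ)^2 * (Real.sin (θ₁ τ))^2) τ ∧
        HasDerivAt θ₁ (-(T₁ τ) - (3/2) * (1 - T₁ τ) * Real.sin (2 * θ₁ τ)) τ) ∧
       (∀ τ : ℝ, T₁ τ ∈ Set.Ioo (0:ℝ) 1) ∧
       Tendsto (fun τ => (T₁ τ, θ₁ τ)) atBot (nhds ((0:ℝ), (0:ℝ)))) →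
      ((∀ τ : ℝ,
        HasDerivAt T₂ (3 * T₂ τ * (1 - T₂ τ)^2 * (Real.sin (θ₂ τ))^2) τ ∧
        HasDerivAt θ₂ (-(T₂ τ) - (3/2) * (1 - T₂ τ) * Real.sin (2 * θ₂ τ)) τ) ∧
       (∀ τ : ℝ, T₂ τ ∈ Set.Ioo (0:ℝ) 1) ∧
       Tendsto (fun τ => (T₂ τ, θ₂ τ)) atBot (nhds ((0:ℝ), (0:ℝ)))) →
      ∃ c : ℝ, ∀ τ : ℝ, T₂ τ = T₁ (τ + c) ∧ θ₂ τ = θ₁ (τ + c)) := by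
  refine ⟨?_, fun T₁ θ₁ T₂ θ₂ ⟨h₁, hT₁, hlim₁⟩ ⟨h₂, hT₂, hlim₂⟩ ↦
    IsFieldSolution.eq_translate_of_tendsto h₁ hT₁ hlim₁ h₂ hT₂ hlim₂⟩
  obtain ⟨T, θ, h, hT, hw⟩ := exists_isFieldSolution_mem_deSitterWedge_Iic
  exact ⟨T, θ, h, hT, h.tendsto_of_mem_deSitterWedge hT hw⟩
end

section
/- Along any solution (T, θ) of the averaged system dT/dτ = (3/2)T(1−T)², dθ/dτ = −T with T(τ) ∈ (0,1) for all τ in an interval J, the quantity θ(τ) + 2/(3(1 − T(τ))) is constant on J; equivalently, θ = −2/(3(1−T)) + C where C = θ(τ₀) + 2/(3(1−T(τ₀))) for any τ₀ ∈ J. -/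
open Real Set

/-- Along any solution of the averaged system dT/dτ = (3/2)T(1−T)²,
dθ/dτ = −T with 0 < T < 1 on an interval, the quantity θ + 2/(3(1−T)) is constant. -/
theorem stmt_13 (a b : ℝ) (T θ : ℝ → ℝ)
    (hT : ∀ τ ∈ Set.Ioo a b, HasDerivAt T ((3/2) * T τ * (1 - T τ)^2) τ)
    (hθ : ∀ τ ∈ Set.Ioo a b, HasDerivAt θ (-(T τ)) τ)
    (hrange : ∀ τ ∈ Set.Ioo a b, T τ ∈ Set.Ioo (0:ℝ) 1) :
    ∀ τ₀ ∈ Set.Ioo a b, ∀ τ ∈ Set.Ioo a b,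
      θ τ + 2 / (3 * (1 - T τ)) = θ τ₀ + 2 / (3 * (1 - T τ₀)) := by
  have hderiv : ∀ τ ∈ Set.Ioo a b,
      HasDerivAt (fun τ => θ τ + 2 / (3 * (1 - T τ))) 0 τ := by
    intro τ hτ
    have hne : 1 - T τ ≠ 0 := (sub_pos.mpr (hrange τ hτ).2).ne'
    have hden : HasDerivAt (fun τ => 3 * (1 - T τ))
        (3 * -((3/2) * T τ * (1 - T τ)^2)) τ :=
      ((hT τ hτ).const_sub 1).const_mul 3
    have hquot := (hasDerivAt_const τ (2 : ℝ)).fun_div hden (mul_ne_zero three_ne_zero hne)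
    refine ((hθ τ hτ).fun_add hquot).congr_deriv ?_
    field_simp
    ring
  intro τ₀ hτ₀ τ hτ
  exact isOpen_Ioo.is_const_of_deriv_eq_zero isPreconnected_Ioo
    (fun x hx => (hderiv x hx).differentiableAt.differentiableWithinAt)
    (fun x hx => (hderiv x hx).deriv) hτ hτ₀
end

section
/- Let h be a C³ function on a neighborhood of 0 in ℝ with h(0) = 0 and h′(0) = 0, satisfying the center manifold equation T(1−T)² sin²((h(T)−T)/3)·(h′(T) − 1) + T + (3/2)(1−T) sin((2/3)(h(T)−T)) = 0 identically near 0. Then h″(0) = −2 and h‴(0) = −52/9. Equivalently, the function θ(T) := (h(T) − T)/3 has Taylor expansion θ(T) = −(1/3)(T + T² + (26/27)T³) + O(T⁴) as T → 0. -/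
open Real Set Filter Asymptotics

/-- Taylor's theorem in Peano form at a point where the function is only locally `C^n`. -/
lemma ContDiffAt.isLittleO_sub_sum_iteratedDeriv {f : ℝ → ℝ} {x₀ : ℝ} {n : ℕ}
    (hf : ContDiffAt ℝ n f x₀) :
    (fun x => f x - ∑ k ∈ Finset.range (n + 1),
      iteratedDeriv k f x₀ / (k.factorial : ℝ) * (x - x₀) ^ k)
      =o[nhds x₀] fun x => (x - x₀) ^ n := by
  obtain ⟨u, hu, hfu⟩ := hf.contDiffOn le_rfl (by simp)
  obtain ⟨ε, hε, hball⟩ := Metric.mem_nhds_iff.1 hu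
  have hx₀ : x₀ ∈ Metric.ball x₀ ε := Metric.mem_ball_self hε
  have ht := taylor_isLittleO (convex_ball x₀ ε) hx₀ (hfu.mono hball)
  rw [Metric.isOpen_ball.nhdsWithin_eq hx₀] at ht
  refine ht.congr_left fun x => ?_
  rw [taylor_within_apply]
  congr 1
  refine Finset.sum_congr rfl fun k _ => ?_
  rw [iteratedDerivWithin_of_isOpen Metric.isOpen_ball hx₀, smul_eq_mul]
  ring

lemma eq_zero_of_const_mul_pow_isLittleO_pow {c : ℝ} {n : ℕ}
    (hc : (fun x : ℝ => c * x ^ n) =o[nhds 0] fun x => x ^ n) : c = 0 := by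
  by_contra hne
  rw [isLittleO_const_mul_left_iff hne] at hc
  refine isLittleO_irrefl' ?_ hc
  have : ∃ᶠ x : ℝ in nhds 0, x ≠ 0 :=
    (eventually_mem_nhdsWithin (a := (0 : ℝ)) (s := {0}ᶜ)).frequently.filter_mono
      nhdsWithin_le_nhds
  exact this.mono fun x hx => by simpa using fun h => absurd h hx

lemma eq_zero_of_isLittleO_cube {a b : ℝ}
    (hab : (fun x : ℝ => a * x ^ 2 + b * x ^ 3) =o[nhds 0] fun x => x ^ 3) :
    a = 0 ∧ b = 0 := by
  have ha : a = 0 := by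
    have h32 : (fun x : ℝ => x ^ 3) =o[nhds 0] fun x => x ^ 2 :=
      isLittleO_pow_pow (by norm_num)
    exact eq_zero_of_const_mul_pow_isLittleO_pow
      (((hab.trans h32).sub (h32.const_mul_left b)).congr_left fun x => by ring)
  subst ha
  exact ⟨rfl, eq_zero_of_const_mul_pow_isLittleO_pow (hab.congr_left fun x => by ring)⟩

lemma isBigO_sin_sub_cubic :
    (fun x : ℝ => sin x - (x - x ^ 3 / 6)) =O[nhds 0] fun x => x ^ 5 := by
  refine IsBigO.of_bound (1 / 100) ?_
  filter_upwards [Metric.closedBall_mem_nhds (0 : ℝ) one_pos] with x hx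
  have := Real.sin_bound (x := x) (by simpa using hx)
  simp only [norm_eq_abs, abs_pow]
  linarith

/-- The cubic expansion of the center manifold, from the a priori orders `O(T²)` of the graph
and `O(T)` of its derivative. -/
lemma isBigO_centerManifold {h h' : ℝ → ℝ}
    (hh : h =O[nhds 0] fun T => T ^ 2) (hh' : h' =O[nhds 0] fun T => T)
    (hode : ∀ᶠ T in nhds (0 : ℝ),
      T * (1 - T) ^ 2 * (sin ((h T - T) / 3)) ^ 2 * (h' T - 1)
        + T + (3 / 2) * (1 - T) * sin ((2 / 3) * (h T - T)) = 0) :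
    (fun T => (h T - T) / 3 + (1 / 3) * (T + T ^ 2 + (26 / 27) * T ^ 3))
      =O[nhds (0 : ℝ)] fun T => T ^ 4 := by
  have hpow {m n : ℕ} (hmn : n ≤ m) : (fun T : ℝ => T ^ m) =O[nhds 0] fun T => T ^ n := by
    rcases hmn.eq_or_lt with rfl | hlt
    · exact isBigO_refl _ _
    · exact (isLittleO_pow_pow hlt).isBigO
  have hid : (fun T : ℝ => T) =O[nhds 0] fun T => T ^ 1 := by
    simpa using isBigO_refl (fun T : ℝ => T) (nhds 0)
  have hbdd {g : ℝ → ℝ} (hg : ContinuousAt g 0) : g =O[nhds 0] fun _ => (1 : ℝ) :=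
    hg.tendsto.isBigO_one ℝ
  set θ : ℝ → ℝ := fun T => (h T - T) / 3 with hθ
  have hθ2 : (fun T => θ T + T / 3) =O[nhds 0] fun T => T ^ 2 :=
    (hh.const_mul_left (1 / 3)).congr_left fun T => by simp only [hθ]; ring
  have hθ1 : θ =O[nhds 0] fun T => T ^ 1 :=
    ((hθ2.trans (hpow one_le_two)).sub (hid.const_mul_left (1 / 3))).congr_left
      fun T => by ring
  have hθ0 : Tendsto θ (nhds 0) (nhds 0) :=
    hθ1.trans_tendsto (by simp only [pow_one]; exact tendsto_id)
  have hθcube : (fun T => θ T ^ 3 + T ^ 3 / 27) =O[nhds 0] fun T => T ^ 4 := by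
    have hquad : (fun T => θ T ^ 2 - θ T * (T / 3) + T ^ 2 / 9) =O[nhds 0] fun T => T ^ 2 := by
      have e1 := (hθ1.pow 2)
      have e2 := (hθ1.mul hid).const_mul_left (1 / 3)
      have e3 := (hid.pow 2).const_mul_left (1 / 9)
      simp only [← pow_mul, ← pow_add] at e1 e2 e3
      exact ((e1.sub e2).add e3).congr_left fun T => by ring
    exact (hθ2.mul hquad).congr (fun T => by ring) fun T => by ring
  have hsin2 : (fun T => sin (2 * θ T) - (2 * θ T - (2 * θ T) ^ 3 / 6)) =O[nhds 0]
      fun T => T ^ 4 := by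
    have hlim : Tendsto (fun T => 2 * θ T) (nhds 0) (nhds 0) := by
      simpa using hθ0.const_mul 2
    have e := (hθ1.const_mul_left 2).pow 5
    simp only [← pow_mul] at e
    exact ((isBigO_sin_sub_cubic.comp_tendsto hlim).trans e).trans (hpow (by norm_num))
  have hsin : (fun T => sin (θ T) + T / 3) =O[nhds 0] fun T => T ^ 2 := by
    have e := isBigO_sin_sub_cubic.comp_tendsto hθ0
    have e5 := hθ1.pow 5
    have e3 := hθ1.pow 3
    simp only [← pow_mul] at e5 e3
    exact (((e.trans (e5.trans (hpow (by norm_num)))).sub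
      ((e3.trans (hpow (by norm_num))).const_mul_left (1 / 6))).add hθ2).congr_left
      fun T => by simp only [Function.comp]; ring
  have hsinsq : (fun T => sin (θ T) ^ 2 - T ^ 2 / 9) =O[nhds 0] fun T => T ^ 3 := by
    have e : (fun T => sin (θ T) - T / 3) =O[nhds 0] fun T => T ^ 1 :=
      ((hsin.trans (hpow one_le_two)).sub (hid.const_mul_left (2 / 3))).congr_left
        fun T => by ring
    exact (hsin.mul e).congr (fun T => by ring) fun T => by ring
  have hcoef : (fun T => T * (1 - T) ^ 2 * sin (θ T) ^ 2 * (h' T - 1) + T ^ 3 / 9)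
      =O[nhds 0] fun T => T ^ 4 := by
    have hd1 : (fun T => (1 - T) ^ 2 * (h' T - 1) + 1) =O[nhds 0] fun T => T ^ 1 := by
      have e1 := (hbdd (g := fun T => (1 - T) ^ 2) (by fun_prop)).mul (hh'.trans hid)
      have e2 := (hbdd (g := fun T => 2 - T) (by fun_prop)).mul hid
      exact (e1.add (e2.congr_right fun T => by ring)).congr
        (fun T => by ring) fun T => by ring
    have hd0 : (fun T => (1 - T) ^ 2 * (h' T - 1)) =O[nhds 0] fun _ => (1 : ℝ) :=
      ((hd1.trans (by simpa using hpow (zero_le_one' ℕ))).sub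
        (isBigO_refl (fun _ : ℝ => (1 : ℝ)) _)).congr_left fun T => by ring
    have e1 := (hid.mul hsinsq).mul hd0
    have e2 := ((hid.pow 3).mul hd1).const_mul_left (1 / 9)
    refine IsBigO.congr_left (IsBigO.add (e1.congr_right fun T => ?_)
      (e2.congr_right fun T => ?_)) fun T => ?_ <;> ring
  have hone : (fun T => 1 - T) =O[nhds 0] fun _ : ℝ => (1 : ℝ) := hbdd (by fun_prop)
  have hmul : (fun T => (1 - T) * (θ T + (1 / 3) * (T + T ^ 2 + (26 / 27) * T ^ 3)))
      =O[nhds 0] fun T => T ^ 4 := by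
    have e1 := ((hone.mul hsin2).congr_right fun T => one_mul _).const_mul_left (1 / 2)
    have e2 := ((hone.mul hθcube).congr_right fun T => one_mul _).const_mul_left (2 / 3)
    have e3 := hcoef.const_mul_left (1 / 3)
    have e4 := (hpow (le_refl 4)).const_mul_left (-(26 / 81) + 2 / 81)
    refine ((e2.sub (e1.add e3)).add e4).congr' ?_ EventuallyEq.rfl
    filter_upwards [hode] with T hT
    have harg : (2 / 3) * (h T - T) = 2 * θ T := by simp only [hθ]; ring
    rw [harg] at hT
    change T * (1 - T) ^ 2 * sin (θ T) ^ 2 * (h' T - 1) + T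
      + 3 / 2 * (1 - T) * sin (2 * θ T) = 0 at hT
    linear_combination -(1 / 3) * hT
  have hinv : (fun T => (1 - T)⁻¹) =O[nhds 0] fun _ : ℝ => (1 : ℝ) :=
    hbdd (ContinuousAt.inv₀ (by fun_prop) (by norm_num))
  refine ((hinv.mul hmul).congr_right fun T => one_mul _).congr' ?_ EventuallyEq.rfl
  filter_upwards [gt_mem_nhds (zero_lt_one' ℝ)] with T hT
  exact inv_mul_cancel_left₀ (sub_ne_zero.2 (ne_of_gt hT)) _

/-- For any C³ graph v = h(T) of the center manifold of dS₊ (h(0) = 0,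
h′(0) = 0, satisfying the invariance ODE near 0), one has h″(0) = −2, h‴(0) = −52/9;
equivalently θ(T) = (h(T) − T)/3 = −(1/3)(T + T² + (26/27)T³) + O(T⁴). -/
theorem stmt_14 (h : ℝ → ℝ) (hreg : ContDiffAt ℝ 3 h 0)
    (h0 : h 0 = 0) (h1 : deriv h 0 = 0)
    (hode : ∀ᶠ T in nhds (0:ℝ),
      T * (1 - T)^2 * (Real.sin ((h T - T) / 3))^2 * (deriv h T - 1)
        + T + (3/2) * (1 - T) * Real.sin ((2/3) * (h T - T)) = 0) :
    iteratedDeriv 2 h 0 = -2 ∧ iteratedDeriv 3 h 0 = -52/9 ∧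
    (fun T => (h T - T) / 3 + (1/3) * (T + T^2 + (26/27) * T^3))
      =O[nhds (0:ℝ)] (fun T => T^4) := by
  have htaylor : (fun T => h T - (iteratedDeriv 2 h 0 / 2 * T ^ 2
      + iteratedDeriv 3 h 0 / 6 * T ^ 3)) =o[nhds 0] fun T => T ^ 3 := by
    refine (ContDiffAt.isLittleO_sub_sum_iteratedDeriv (n := 3) hreg).congr
      (fun T => ?_) fun T => by simp
    simp [Finset.sum_range_succ, iteratedDeriv_zero, iteratedDeriv_one, h0, h1,
      Nat.factorial]
  have h32 : (fun T : ℝ => T ^ 3) =O[nhds 0] fun T => T ^ 2 :=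
    (isLittleO_pow_pow (by norm_num)).isBigO
  have hh : h =O[nhds 0] fun T => T ^ 2 :=
    ((htaylor.isBigO.trans h32).add
      (((isBigO_refl (fun T : ℝ => T ^ 2) _).const_mul_left (iteratedDeriv 2 h 0 / 2)).add
        (h32.const_mul_left (iteratedDeriv 3 h 0 / 6)))).congr_left fun T => by ring
  have hh' : deriv h =O[nhds 0] fun T => T := by
    have hd : ContDiffAt ℝ 2 (deriv h) 0 := hreg.derivWithin (by norm_num)
    simpa [h1] using (hd.differentiableAt (by norm_num)).isBigO_sub
  have hmain := isBigO_centerManifold hh hh' hode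
  have hcube := hmain.trans_isLittleO (isLittleO_pow_pow (by norm_num : 3 < 4))
  have hcoeff := eq_zero_of_isLittleO_cube (a := iteratedDeriv 2 h 0 / 2 + 1)
    (b := iteratedDeriv 3 h 0 / 6 + 26 / 27)
    (((hcube.const_mul_left 3).sub htaylor).congr_left fun T => by ring)
  exact ⟨by linarith [hcoeff.1], by linarith [hcoeff.2], hmain⟩
end

section
/- Let h̃ be a C⁵ function on a neighborhood of 0 in ℝ with h̃(0) = 0 and h̃′(0) = 0, satisfying the center manifold equation T̃ sin²((h̃(T̃)−T̃)/3)·(h̃′(T̃) − 1) + T̃ + (3/2) sin((2/3)(h̃(T̃)−T̃)) = 0 identically near 0. Then h̃″(0) = 0, h̃‴(0) = 2/9, h̃⁗(0) = 0, and h̃⁽⁵⁾(0) = −16/9. Equivalently, θ(T̃) := (h̃(T̃) − T̃)/3 has Taylor expansion θ(T̃) = −(1/3)(T̃ − (1/27)T̃³ + (2/135)T̃⁵) + O(T̃⁶) as T̃ → 0. -/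
open Real Set Filter Asymptotics

/-- Taylor's theorem at the origin for a function that is only `C^n` at that point. -/
theorem ContDiffAt.isLittleO_sub_taylor_zero {f : ℝ → ℝ} {n : ℕ} (hf : ContDiffAt ℝ n f 0) :
    (fun x => f x - ∑ k ∈ Finset.range (n + 1), iteratedDeriv k f 0 / k.factorial * x ^ k)
      =o[nhds 0] fun x => x ^ n := by
  obtain ⟨u, hu, hfu⟩ := hf.contDiffOn (m := n) le_rfl (by simp)
  obtain ⟨ε, hε, hball⟩ := Metric.mem_nhds_iff.1 hu
  have h0 : (0 : ℝ) ∈ Metric.ball (0 : ℝ) ε := Metric.mem_ball_self hε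
  have key := taylor_isLittleO (convex_ball (0 : ℝ) ε) h0 (hfu.mono hball)
  rw [Metric.isOpen_ball.nhdsWithin_eq h0] at key
  refine key.congr (fun x => ?_) (fun x => by simp)
  rw [taylor_within_apply]
  congr 1
  refine Finset.sum_congr rfl fun k _ => ?_
  rw [iteratedDerivWithin_of_isOpen Metric.isOpen_ball h0]
  simp only [sub_zero, smul_eq_mul]
  ring

theorem iteratedDeriv_eq_zero_of_isLittleO {f : ℝ → ℝ} {n : ℕ} (hf : ContDiffAt ℝ n f 0)
    (ho : f =o[nhds 0] fun x => x ^ n) {k : ℕ} (hk : k ≤ n) : iteratedDeriv k f 0 = 0 := by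
  induction k using Nat.strong_induction_on with
  | _ k ih =>
    have hT := (hf.of_le (by exact_mod_cast hk : (k : WithTop ℕ∞) ≤ n)).isLittleO_sub_taylor_zero
    have hfk : f =o[nhds 0] fun x : ℝ => x ^ k := by
      rcases hk.eq_or_lt with rfl | hlt
      · exact ho
      · exact ho.trans (isLittleO_pow_pow hlt)
    have hsum : ∀ x : ℝ, ∑ j ∈ Finset.range (k + 1), iteratedDeriv j f 0 / j.factorial * x ^ j
        = iteratedDeriv k f 0 / k.factorial * x ^ k := fun x => by
      rw [Finset.sum_range_succ, Finset.sum_eq_zero, zero_add]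
      intro j hj
      have hj' := Finset.mem_range.1 hj
      rw [ih j hj' (hj'.le.trans hk), zero_div, zero_mul]
    have hc : (fun x : ℝ => iteratedDeriv k f 0 / k.factorial * x ^ k)
        =o[nhds 0] fun x => x ^ k :=
      (hfk.sub hT).congr_left fun x => by rw [hsum]; ring
    by_contra hne
    have hc0 : iteratedDeriv k f 0 / k.factorial ≠ 0 := div_ne_zero hne (by positivity)
    refine isLittleO_irrefl' ?_ ((isLittleO_const_mul_left_iff hc0).1 hc)
    have hfreq : ∃ᶠ x : ℝ in nhds 0, x ≠ 0 := by
      have h1 : ∃ᶠ x : ℝ in nhdsWithin 0 {0}ᶜ, x ≠ 0 :=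
        (eventually_mem_nhdsWithin (a := (0 : ℝ)) (s := {0}ᶜ)).frequently
      exact h1.filter_mono nhdsWithin_le_nhds
    exact hfreq.mono fun x hx => by simp [hx]

theorem ContDiffAt.deriv_isBigO_pow {f : ℝ → ℝ} {n : ℕ} (hf : ContDiffAt ℝ (n + 1 : ℕ) f 0)
    (hO : f =O[nhds 0] fun x => x ^ (n + 1)) : deriv f =O[nhds 0] fun x => x ^ n := by
  have hlo : f =o[nhds 0] fun x => x ^ n := hO.trans_isLittleO (isLittleO_pow_pow n.lt_succ_self)
  have hfn : ContDiffAt ℝ n f 0 := hf.of_le (by exact_mod_cast n.le_succ)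
  have hT := (hf.derivWithin (m := n) (by simp)).isLittleO_sub_taylor_zero
  have hsum : ∀ x : ℝ, ∑ j ∈ Finset.range (n + 1),
      iteratedDeriv j (deriv f) 0 / j.factorial * x ^ j
        = iteratedDeriv n (deriv f) 0 / n.factorial * x ^ n := fun x => by
    rw [Finset.sum_range_succ, Finset.sum_eq_zero, zero_add]
    intro j hj
    rw [← iteratedDeriv_succ', iteratedDeriv_eq_zero_of_isLittleO hfn hlo (Finset.mem_range.1 hj),
      zero_div, zero_mul]
  exact (hT.isBigO.add (isBigO_const_mul_self (iteratedDeriv n (deriv f) 0 / n.factorial)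
    (fun x : ℝ => x ^ n) _)).congr_left fun x => by rw [hsum]; ring

theorem exists_eventually_eq_pow_mul {f : ℝ → ℝ} {n : ℕ} (hf : f =O[nhds 0] fun x => x ^ n) :
    ∃ φ : ℝ → ℝ, φ =O[nhds 0] (fun _ => (1 : ℝ)) ∧ ∀ᶠ x in nhds 0, f x = x ^ n * φ x := by
  obtain ⟨φ, hφ, h⟩ := isBigO_iff_exists_eq_mul.1 hf
  exact ⟨φ, hφ.isBigO_one ℝ, h.mono fun x hx => by rw [hx, Pi.mul_apply, mul_comm]⟩

theorem Continuous.comp_isBigO_one {α E : Type*} [NormedAddCommGroup E] [ProperSpace E]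
    {l : Filter α} {g : E → ℝ} (hg : Continuous g) {u : α → E}
    (hu : u =O[l] fun _ => (1 : ℝ)) : (fun x => g (u x)) =O[l] fun _ => (1 : ℝ) := by
  obtain ⟨c, hc⟩ := hu.bound
  obtain ⟨C, hC⟩ := (isCompact_closedBall (0 : E) c).exists_bound_of_continuousOn hg.continuousOn
  refine IsBigO.of_bound C (hc.mono fun x hx => ?_)
  rw [norm_one, mul_one] at hx ⊢
  exact hC _ (mem_closedBall_zero_iff.2 hx)

theorem exists_sin_eq_taylor : ∃ S : ℝ → ℝ, S =O[nhds 0] (fun _ => (1 : ℝ)) ∧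
    ∀ᶠ x in nhds 0, sin x = x - x ^ 3 / 6 + x ^ 5 / 120 + x ^ 7 * S x := by
  have hT := (contDiff_sin.contDiffAt (n := (7 : ℕ)) (x := 0)).isLittleO_sub_taylor_zero
  have hO : (fun x => sin x - (x - x ^ 3 / 6 + x ^ 5 / 120)) =O[nhds 0] fun x => x ^ 7 := by
    refine (hT.isBigO.add (isBigO_const_mul_self (-1 / 5040) (fun x : ℝ => x ^ 7) _)).congr_left
      fun x => ?_
    simp [Finset.sum_range_succ, iteratedDeriv_succ, Nat.factorial]
    ring
  obtain ⟨S, hS, h⟩ := exists_eventually_eq_pow_mul hO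
  exact ⟨S, hS, h.mono fun x hx => by linarith⟩

/-- With `θ = T * a`, `τ = T ^ 2`, `q` the derivative of `h` and `r`, `s` the order seven remainders of the sine at
`θ` and `2 * θ`, the center manifold equation reads `h = T ^ 3 * centerRHS τ a q r s`. -/
noncomputable def centerRHS (τ a q r s : ℝ) : ℝ :=
  2 * a ^ 3 - 2 / 5 * τ * a ^ 5 - 192 * τ ^ 2 * a ^ 7 * s
    - (a - τ * a ^ 3 / 6 + τ ^ 2 * a ^ 5 / 120 + τ ^ 3 * a ^ 7 * r) ^ 2 * (q - 1)

theorem eq_centerRHS {T a q r s y : ℝ} (hy : y = T + 3 * (T * a))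
    (hr : sin (T * a) = T * a - (T * a) ^ 3 / 6 + (T * a) ^ 5 / 120 + (T * a) ^ 7 * r)
    (hs : sin (2 * (T * a)) = 2 * (T * a) - (2 * (T * a)) ^ 3 / 6 + (2 * (T * a)) ^ 5 / 120
      + (2 * (T * a)) ^ 7 * s)
    (hode : T * sin ((y - T) / 3) ^ 2 * (q - 1) + T + 3 / 2 * sin (2 / 3 * (y - T)) = 0) :
    y = T ^ 3 * centerRHS (T ^ 2) a q r s := by
  have e1 : (y - T) / 3 = T * a := by rw [hy]; ring
  have e2 : 2 / 3 * (y - T) = 2 * (T * a) := by rw [hy]; ring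
  rw [e1, e2, hr, hs] at hode
  rw [centerRHS]
  linear_combination hy + hode

theorem exists_centerRHS_first_order : ∃ F : ℝ × ℝ × ℝ × ℝ × ℝ → ℝ, Continuous F ∧
    ∀ τ b z r s, centerRHS τ (-1 / 3 + τ * b) (τ * z) r s = 1 / 27 + τ * F (τ, b, z, r, s) := by
  refine ⟨fun p =>
    let τ := p.1; let b := p.2.1; let z := p.2.2.1; let r := p.2.2.2.1; let s := p.2.2.2.2
    let a := -1 / 3 + τ * b
    let t := b - a ^ 3 / 6 + τ * a ^ 5 / 120 + τ ^ 2 * a ^ 7 * r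
    let d := -2 / 3 * t + τ * t ^ 2
    2 * (b / 3 - τ * b ^ 2 + τ ^ 2 * b ^ 3) - 2 / 5 * a ^ 5 - 192 * τ * a ^ 7 * s
      - (z / 9 - d + τ * d * z), by fun_prop, fun τ b z r s => ?_⟩
  simp only [centerRHS]
  ring

theorem exists_centerRHS_second_order : ∃ F : ℝ × ℝ × ℝ × ℝ × ℝ → ℝ, Continuous F ∧
    ∀ τ c z r s, centerRHS τ (-1 / 3 + τ * (1 / 81 + τ * c)) (τ * (1 / 9 + τ * z)) r s
      = 1 / 27 + τ * (-2 / 135 + τ * F (τ, c, z, r, s)) := by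
  refine ⟨fun p =>
    let τ := p.1; let c := p.2.1; let y := p.2.2.1; let r := p.2.2.2.1; let s := p.2.2.2.2
    let b := 1 / 81 + τ * c
    let z := 1 / 9 + τ * y
    let a := -1 / 3 + τ * b
    let a3 := b / 3 - τ * b ^ 2 + τ ^ 2 * b ^ 3
    let a5 := 5 * b / 81 - 10 / 27 * τ * b ^ 2 + 10 / 9 * τ ^ 2 * b ^ 3
      - 5 / 3 * τ ^ 3 * b ^ 4 + τ ^ 4 * b ^ 5
    let t' := c - a3 / 6 + a ^ 5 / 120 + τ * a ^ 7 * r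
    let t := 1 / 54 + τ * t'
    let d := -2 / 3 * t + τ * t ^ 2
    2 * (c / 3 - b ^ 2 + τ * b ^ 3) - 2 / 5 * a5 - 192 * a ^ 7 * s
      - (y / 9 + 2 / 3 * t' - t ^ 2 + d * z), by fun_prop, fun τ c z r s => ?_⟩
  simp only [centerRHS]
  ring

/-- For any C⁵ graph ṽ = h̃(T̃) of the center manifold of dS₊ in the
early-time variables (h̃(0) = 0, h̃′(0) = 0, satisfying the invariance ODE near 0),
one has h̃″(0) = 0, h̃‴(0) = 2/9, h̃⁗(0) = 0, h̃⁽⁵⁾(0) = −16/9; equivalently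
θ(T̃) = (h̃(T̃) − T̃)/3 = −(1/3)(T̃ − (1/27)T̃³ + (2/135)T̃⁵) + O(T̃⁶). -/
theorem stmt_15 (h : ℝ → ℝ) (hreg : ContDiffAt ℝ 5 h 0)
    (h0 : h 0 = 0) (h1 : deriv h 0 = 0)
    (hode : ∀ᶠ T in nhds (0:ℝ),
      T * (Real.sin ((h T - T) / 3))^2 * (deriv h T - 1)
        + T + (3/2) * Real.sin ((2/3) * (h T - T)) = 0) :
    iteratedDeriv 2 h 0 = 0 ∧ iteratedDeriv 3 h 0 = 2/9 ∧
    iteratedDeriv 4 h 0 = 0 ∧ iteratedDeriv 5 h 0 = -16/9 ∧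
    (fun T => (h T - T) / 3 + (1/3) * (T - (1/27) * T^3 + (2/135) * T^5))
      =O[nhds (0:ℝ)] (fun T => T^6) := by
  obtain ⟨S, hS, hsin⟩ := exists_sin_eq_taylor
  set θ : ℝ → ℝ := fun T => (h T - T) / 3 with hθ
  have hθ0 : Tendsto θ (nhds 0) (nhds 0) := by
    have : ContinuousAt θ 0 := (hreg.continuousAt.sub continuousAt_id).div_const 3
    simpa [ContinuousAt, hθ, h0] using this
  have h2θ0 : Tendsto (fun T => 2 * θ T) (nhds 0) (nhds 0) := by simpa using hθ0.const_mul 2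
  set r : ℝ → ℝ := fun T => S (θ T)
  set s : ℝ → ℝ := fun T => S (2 * θ T)
  have hr : r =O[nhds 0] fun _ => (1 : ℝ) := hS.comp_tendsto hθ0
  have hs : s =O[nhds 0] fun _ => (1 : ℝ) := hS.comp_tendsto h2θ0
  have hτ : (fun T : ℝ => T ^ 2) =O[nhds 0] fun _ => (1 : ℝ) :=
    ((continuous_pow 2).tendsto (0 : ℝ)).isBigO_one ℝ
  have expand : ∀ a : ℝ → ℝ, (∀ᶠ T in nhds 0, h T = T + 3 * (T * a T)) →
      ∀ᶠ T in nhds 0, h T = T ^ 3 * centerRHS (T ^ 2) (a T) (deriv h T) (r T) (s T) := by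
    intro a ha
    filter_upwards [ha, hode, hθ0.eventually hsin, h2θ0.eventually hsin] with T haT hT hs1 hs2
    have e : θ T = T * a T := by simp only [hθ, haT]; ring
    refine eq_centerRHS haT ?_ ?_ hT
    · rw [← e]; exact hs1
    · rw [← e]; exact hs2
  have hq : deriv h =O[nhds 0] fun _ => (1 : ℝ) :=
    (hreg.derivWithin (m := 0) (by norm_num)).continuousAt.tendsto.isBigO_one ℝ
  have hO3 : h =O[nhds 0] fun T => T ^ 3 := by
    have hO1 : h =O[nhds 0] fun T => T ^ 1 := by
      simpa [h0] using (hreg.differentiableAt (by norm_num)).isBigO_sub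
    obtain ⟨φ, hφ, hφe⟩ := exists_eventually_eq_pow_mul hO1
    have hF : Continuous fun p : ℝ × ℝ × ℝ × ℝ × ℝ =>
        centerRHS p.1 ((p.2.1 - 1) / 3) p.2.2.1 p.2.2.2.1 p.2.2.2.2 := by
      unfold centerRHS; fun_prop
    have hb := hF.comp_isBigO_one
      (hτ.prod_left (hφ.prod_left (hq.prod_left (hr.prod_left hs))))
    have he := expand (fun T => (φ T - 1) / 3) (hφe.mono fun T hT => by rw [hT]; ring)
    simpa using ((isBigO_refl (fun T : ℝ => T ^ 3) _).mul hb).congr' (he.mono fun _ e => e.symm)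
      EventuallyEq.rfl
  have hO5 : (fun T => h T - T ^ 3 / 27) =O[nhds 0] fun T => T ^ 5 := by
    obtain ⟨φ, hφ, hφe⟩ := exists_eventually_eq_pow_mul hO3
    obtain ⟨z, hz, hze⟩ := exists_eventually_eq_pow_mul
      ((hreg.of_le (by norm_num : ((2 + 1 : ℕ) : WithTop ℕ∞) ≤ 5)).deriv_isBigO_pow hO3)
    obtain ⟨F, hF, hFe⟩ := exists_centerRHS_first_order
    have hb := hF.comp_isBigO_one
      (hτ.prod_left ((hφ.const_mul_left (1 / 3)).prod_left (hz.prod_left (hr.prod_left hs))))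
    have he := expand (fun T => -1 / 3 + T ^ 2 * (1 / 3 * φ T))
      (hφe.mono fun T hT => by rw [hT]; ring)
    refine (((isBigO_refl (fun T : ℝ => T ^ 5) _).mul hb).congr' ?_
      (Eventually.of_forall fun T => mul_one _))
    filter_upwards [he, hze] with T e ez
    rw [e, ez, hFe]
    ring
  have hO7 : (fun T => h T - (T ^ 3 / 27 - 2 / 135 * T ^ 5)) =O[nhds 0] fun T => T ^ 7 := by
    obtain ⟨φ, hφ, hφe⟩ := exists_eventually_eq_pow_mul hO5
    have hreg5 : ContDiffAt ℝ (4 + 1 : ℕ) (fun T => h T - T ^ 3 / 27) 0 :=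
      ContDiffAt.sub (by exact_mod_cast hreg) (by fun_prop)
    obtain ⟨z, hz, hze⟩ := exists_eventually_eq_pow_mul (hreg5.deriv_isBigO_pow hO5)
    obtain ⟨F, hF, hFe⟩ := exists_centerRHS_second_order
    have hb := hF.comp_isBigO_one
      (hτ.prod_left ((hφ.const_mul_left (1 / 3)).prod_left (hz.prod_left (hr.prod_left hs))))
    have he := expand (fun T => -1 / 3 + T ^ 2 * (1 / 81 + T ^ 2 * (1 / 3 * φ T)))
      (hφe.mono fun T hT => by linear_combination hT)
    have hdiff : ∀ᶠ T in nhds 0, DifferentiableAt ℝ h T :=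
      (hreg.eventually (by simp)).mono fun T hT => hT.differentiableAt (by norm_num)
    refine (((isBigO_refl (fun T : ℝ => T ^ 7) _).mul hb).congr' ?_
      (Eventually.of_forall fun T => mul_one _))
    filter_upwards [he, hze, hdiff] with T e ez hd
    have hd' : deriv h T = T ^ 2 * (1 / 9 + T ^ 2 * z T) := by
      have hsub := (hd.hasDerivAt.sub ((hasDerivAt_pow 3 T).div_const 27)).deriv
      have : deriv (fun T => h T - T ^ 3 / 27) T = deriv h T - T ^ 2 / 9 := by
        refine hsub.trans ?_
        norm_num
        ring
      linear_combination ez - this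
    rw [e, hd', hFe]
    ring
  have hiter : ∀ k ≤ 5, iteratedDeriv k h 0
      = iteratedDeriv k (fun T : ℝ => T ^ 3 / 27 - 2 / 135 * T ^ 5) 0 := by
    intro k hk
    have hp : ContDiff ℝ 5 (fun T : ℝ => T ^ 3 / 27 - 2 / 135 * T ^ 5) := by fun_prop
    have hk' : (k : WithTop ℕ∞) ≤ 5 := by exact_mod_cast hk
    have hz := iteratedDeriv_eq_zero_of_isLittleO (n := 5)
      (by exact_mod_cast hreg.sub hp.contDiffAt)
      (hO7.trans_isLittleO (isLittleO_pow_pow (by norm_num))) hk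
    have hsub := iteratedDeriv_sub (hreg.of_le hk') (hp.contDiffAt.of_le hk')
    exact sub_eq_zero.1 (hsub.symm.trans hz)
  have hpoly : ∀ k, iteratedDeriv k (fun T : ℝ => T ^ 3 / 27 - 2 / 135 * T ^ 5) 0
      = (Nat.descFactorial 3 k : ℝ) * 0 ^ (3 - k) / 27
        - 2 / 135 * ((Nat.descFactorial 5 k : ℝ) * 0 ^ (5 - k)) := by
    intro k
    refine (iteratedDeriv_sub (f := fun T : ℝ => T ^ 3 / 27) (g := fun T : ℝ => 2 / 135 * T ^ 5)
      (n := k) (x := 0) (by fun_prop) (by fun_prop)).trans ?_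
    rw [iteratedDeriv_div_const, iteratedDeriv_const_mul_field, iteratedDeriv_pow,
      iteratedDeriv_pow]
  refine ⟨?_, ?_, ?_, ?_, ?_⟩
  · rw [hiter 2 (by norm_num), hpoly]; norm_num [Nat.descFactorial]
  · rw [hiter 3 (by norm_num), hpoly]; norm_num [Nat.descFactorial]
  · rw [hiter 4 (by norm_num), hpoly]; norm_num [Nat.descFactorial]
  · rw [hiter 5 (by norm_num), hpoly]; norm_num [Nat.descFactorial]
  · refine ((hO7.trans (isLittleO_pow_pow (by norm_num : 6 < 7)).isBigO).const_mul_left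
      (1 / 3)).congr_left fun T => ?_
    ring
end

section
/- Let m > 0 and let (H, φ) be a C² solution of the flat FLRW scalar field equations 3H² = ½φ̇² + ½m²φ², Ḣ = −½φ̇², φ̈ + 3Hφ̇ + m²φ = 0 with H(0) > 0, defined on its maximal forward interval of existence. Then the solution is defined for all t ≥ 0, and H(t) → 0, φ(t) → 0, and φ̇(t) → 0 as t → +∞. -/
open Real Set Filter

open scoped NNReal

/-- Two integral curves of a locally Lipschitz vector field that agree at `0` agree on `[0, b)`. -/
theorem LocallyLipschitz.eqOn_Ico_of_hasDerivAt {E : Type*} [NormedAddCommGroup E]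
    [NormedSpace ℝ E] [ProperSpace E] {v : E → E} (hv : LocallyLipschitz v) {f g : ℝ → E} {b : ℝ}
    (hf : ∀ t ∈ Ico 0 b, HasDerivAt f (v (f t)) t)
    (hg : ∀ t ∈ Ico 0 b, HasDerivAt g (v (g t)) t) (h0 : f 0 = g 0) :
    EqOn f g (Ico 0 b) := by
  intro T hT
  have hsub : Icc 0 T ⊆ Ico 0 b := fun t ht ↦ ⟨ht.1, ht.2.trans_lt hT.2⟩
  have hfc : ContinuousOn f (Icc 0 T) := HasDerivAt.continuousOn fun t ht ↦ hf t (hsub ht)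
  have hgc : ContinuousOn g (Icc 0 T) := HasDerivAt.continuousOn fun t ht ↦ hg t (hsub ht)
  obtain ⟨A, hA⟩ := isCompact_Icc.exists_bound_of_continuousOn hfc
  obtain ⟨B, hB⟩ := isCompact_Icc.exists_bound_of_continuousOn hgc
  obtain ⟨K, hK⟩ := hv.locallyLipschitzOn.exists_lipschitzOnWith_of_compact
    (isCompact_closedBall (0 : E) (max A B))
  refine ODE_solution_unique_of_mem_Icc_right (v := fun _ ↦ v)
    (s := fun _ ↦ Metric.closedBall 0 (max A B)) (fun _ _ ↦ hK) hfc
    (fun t ht ↦ (hf t (hsub (Ico_subset_Icc_self ht))).hasDerivWithinAt) (fun t ht ↦ ?_) hgc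
    (fun t ht ↦ (hg t (hsub (Ico_subset_Icc_self ht))).hasDerivWithinAt) (fun t ht ↦ ?_) h0
    ⟨hT.1, le_rfl⟩
  · simpa using Or.inl (hA t (Ico_subset_Icc_self ht))
  · simpa using Or.inr (hB t (Ico_subset_Icc_self ht))

/-- A bounded Lipschitz vector field is complete. -/
theorem LipschitzWith.exists_forall_hasDerivAt_of_norm_le {E : Type*} [NormedAddCommGroup E]
    [NormedSpace ℝ E] [CompleteSpace E] {v : E → E} {K L : ℝ≥0} (hv : LipschitzWith K v)
    (hL : ∀ x, ‖v x‖ ≤ L) (x₀ : E) :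
    ∃ α : ℝ → E, α 0 = x₀ ∧ ∀ t, HasDerivAt α (v (α t)) t := by
  have key (n : ℕ) : ∃ α : ℝ → E, α 0 = x₀ ∧
      ∀ t ∈ Ioo (-(n + 1) : ℝ) (n + 1), HasDerivAt α (v (α t)) t := by
    have h0 : (0 : ℝ) ∈ Icc (-(n + 1) : ℝ) (n + 1) := by
      constructor <;> linarith [n.cast_nonneg (α := ℝ)]
    have hPL : IsPicardLindelof (fun _ ↦ v) (⟨0, h0⟩ : Icc (-(n + 1) : ℝ) (n + 1)) x₀
        (L * (n + 1)) 0 L K :=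
      { lipschitzOnWith := fun _ _ ↦ hv.lipschitzOnWith
        continuousOn := fun _ _ ↦ continuousOn_const
        norm_le := fun _ _ x _ ↦ hL x
        mul_max_le := by simp }
    obtain ⟨α, hα0, hα⟩ := hPL.exists_eq_forall_mem_Icc_hasDerivWithinAt₀
    exact ⟨α, hα0, fun t ht ↦ (hα t (Ioo_subset_Icc_self ht)).hasDerivAt (Icc_mem_nhds ht.1 ht.2)⟩
  choose β hβ0 hβ using key
  have agree {n k : ℕ} (hnk : n ≤ k) : EqOn (β n) (β k) (Ioo (-(n + 1) : ℝ) (n + 1)) := by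
    have hc : (n : ℝ) ≤ k := by exact_mod_cast hnk
    refine ODE_solution_unique_of_mem_Ioo (v := fun _ ↦ v) (s := fun _ ↦ univ) (t₀ := 0)
      (fun _ _ ↦ hv.lipschitzOnWith) ?_ (fun t ht ↦ ⟨hβ n t ht, trivial⟩)
      (fun t ht ↦ ⟨hβ k t ⟨by linarith [ht.1], by linarith [ht.2]⟩, trivial⟩)
      (by rw [hβ0, hβ0])
    constructor <;> linarith [n.cast_nonneg (α := ℝ)]
  have mem (t : ℝ) : t ∈ Ioo (-(⌈|t|⌉₊ + 1) : ℝ) (⌈|t|⌉₊ + 1) := by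
    have := Nat.le_ceil |t|
    constructor <;> linarith [le_abs_self t, neg_abs_le t]
  refine ⟨fun t ↦ β ⌈|t|⌉₊ t, by simp [hβ0], fun t ↦ ?_⟩
  refine (hβ _ t (mem t)).congr_of_eventuallyEq ?_
  filter_upwards [Ioo_mem_nhds (mem t).1 (mem t).2] with s hs
  rcases le_total ⌈|s|⌉₊ ⌈|t|⌉₊ with h | h
  · exact agree h (mem s)
  · exact (agree h hs).symm

/-- The scalar field equations in the variables `u = 1 / H` and `θ`, where `φ̇ = √6 H cos θ` and
`m φ = √6 H sin θ`, with `u` cut off from below at `a`. -/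
noncomputable def polarField (m a : ℝ) (p : ℝ × ℝ) : ℝ × ℝ :=
  (3 * cos p.2 ^ 2, m + 3 * (sin p.2 * cos p.2) / max p.1 a)

theorem norm_polarField_le {m a : ℝ} (ha : 0 < a) (p : ℝ × ℝ) :
    ‖polarField m a p‖ ≤ 3 + |m| + 3 / a := by
  have hM : a ≤ max p.1 a := le_max_right _ _
  have hs := sin_sq_add_cos_sq p.2
  have hsc : |3 * (sin p.2 * cos p.2)| ≤ 3 := by
    rw [abs_le]
    constructor <;> nlinarith [sq_nonneg (sin p.2 + cos p.2), sq_nonneg (sin p.2 - cos p.2)]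
  have ha3 : 0 ≤ 3 / a := by positivity
  rw [polarField, Prod.norm_def, max_le_iff, Real.norm_eq_abs, Real.norm_eq_abs]
  constructor
  · rw [abs_of_nonneg (by positivity)]
    nlinarith [sq_nonneg (sin p.2), abs_nonneg m]
  · refine (abs_add_le _ _).trans ?_
    have : |3 * (sin p.2 * cos p.2) / max p.1 a| ≤ 3 / a := by
      rw [abs_div, abs_of_pos (ha.trans_le hM)]
      gcongr
    linarith

theorem exists_lipschitzWith_polarField {m a : ℝ} (ha : 0 < a) :
    ∃ K, LipschitzWith K (polarField m a) := by
  have hcos : LipschitzWith 1 fun p : ℝ × ℝ ↦ cos p.2 := by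
    simpa using! lipschitzWith_cos.comp LipschitzWith.prod_snd
  refine ⟨Real.toNNReal (6 + 6 / a + 3 / a ^ 2), LipschitzWith.of_dist_le' fun p q ↦ ?_⟩
  have hθ : |p.2 - q.2| ≤ dist p q := by
    rw [Prod.dist_eq, ← Real.dist_eq]; exact le_max_right _ _
  have hu : |p.1 - q.1| ≤ dist p q := by
    rw [Prod.dist_eq, ← Real.dist_eq]; exact le_max_left _ _
  set D := dist p q
  have hD : 0 ≤ D := dist_nonneg
  have hc := (abs_cos_sub_cos_le p.2 q.2).trans hθ
  have hs := (abs_sin_sub_sin_le p.2 q.2).trans hθ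
  have hM := (abs_max_sub_max_le_abs p.1 q.1 a).trans hu
  have hMp : a ≤ max p.1 a := le_max_right _ _
  have hMq : a ≤ max q.1 a := le_max_right _ _
  set M := max p.1 a
  set N := max q.1 a
  have hMpos := ha.trans_le hMp
  have hNpos := ha.trans_le hMq
  have h1 : 0 ≤ 6 / a * D := by positivity
  have h2 : 0 ≤ 3 / a ^ 2 * D := by positivity
  have c1 := abs_cos_le_one p.2
  have c2 := abs_cos_le_one q.2
  have s1 := abs_sin_le_one p.2
  have s2 := abs_sin_le_one q.2
  rw [Prod.dist_eq, max_le_iff, Real.dist_eq, Real.dist_eq, polarField, polarField]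
  constructor
  · have : 3 * cos p.2 ^ 2 - 3 * cos q.2 ^ 2
        = 3 * ((cos p.2 - cos q.2) * (cos p.2 + cos q.2)) := by ring
    dsimp only
    rw [this, abs_mul, abs_mul, abs_of_pos (by norm_num : (0 : ℝ) < 3)]
    have : |cos p.2 + cos q.2| ≤ 2 := (abs_add_le _ _).trans (by linarith)
    have := mul_le_mul hc this (abs_nonneg _) hD
    linarith
  · have e : (m + 3 * (sin p.2 * cos p.2) / M) - (m + 3 * (sin q.2 * cos q.2) / N)
        = 3 * ((sin p.2 - sin q.2) * cos p.2 + sin q.2 * (cos p.2 - cos q.2)) / M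
          - 3 * (sin q.2 * cos q.2) * (M - N) / (M * N) := by
      field_simp; ring
    dsimp only
    rw [e]
    refine (abs_sub _ _).trans ?_
    have t1 : |3 * ((sin p.2 - sin q.2) * cos p.2 + sin q.2 * (cos p.2 - cos q.2)) / M|
        ≤ 6 * D / a := by
      rw [abs_div, abs_of_pos hMpos]
      gcongr
      rw [abs_mul, abs_of_pos (by norm_num : (0 : ℝ) < 3)]
      have := abs_add_le ((sin p.2 - sin q.2) * cos p.2) (sin q.2 * (cos p.2 - cos q.2))
      rw [abs_mul, abs_mul] at this
      have := mul_le_mul hs c1 (abs_nonneg _) hD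
      have := mul_le_mul s2 hc (abs_nonneg _) zero_le_one
      linarith
    have t2 : |3 * (sin q.2 * cos q.2) * (M - N) / (M * N)| ≤ 3 * D / a ^ 2 := by
      rw [abs_div, abs_of_pos (mul_pos hMpos hNpos), sq]
      gcongr
      rw [abs_mul, abs_mul, abs_mul, abs_of_pos (by norm_num : (0 : ℝ) < 3)]
      have := mul_le_mul s2 c2 (abs_nonneg _) zero_le_one
      have := mul_le_mul this hM (abs_nonneg _) (by norm_num)
      linarith
    calc _ ≤ 6 * D / a + 3 * D / a ^ 2 := add_le_add t1 t2
      _ ≤ _ := by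
        have : (6 + 6 / a + 3 / a ^ 2) * D = 6 * D + (6 * D / a + 3 * D / a ^ 2) := by ring
        linarith

/-- The cut-off polar field has a global integral curve through every `(a, θ₀)`; along it the
cut-off is inactive at nonnegative times. -/
theorem exists_polar_solution (m : ℝ) {a : ℝ} (ha : 0 < a) (θ₀ : ℝ) :
    ∃ u θ : ℝ → ℝ, u 0 = a ∧ θ 0 = θ₀ ∧ ∀ t, 0 ≤ t → a ≤ u t ∧
      HasDerivAt u (3 * cos (θ t) ^ 2) t ∧
      HasDerivAt θ (m + 3 * (sin (θ t) * cos (θ t)) / u t) t := by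
  obtain ⟨K, hK⟩ := exists_lipschitzWith_polarField (m := m) ha
  obtain ⟨α, hα0, hα⟩ := hK.exists_forall_hasDerivAt_of_norm_le
    (L := ⟨3 + |m| + 3 / a, by positivity⟩) (norm_polarField_le ha) (a, θ₀)
  have hu (t : ℝ) : HasDerivAt (fun t ↦ (α t).1) (3 * cos (α t).2 ^ 2) t := by
    exact (hasFDerivAt_fst (𝕜 := ℝ)).comp_hasDerivAt t (hα t)
  have hθ (t : ℝ) : HasDerivAt (fun t ↦ (α t).2)
      (m + 3 * (sin (α t).2 * cos (α t).2) / max (α t).1 a) t := by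
    exact (hasFDerivAt_snd (𝕜 := ℝ)).comp_hasDerivAt t (hα t)
  have hmono : Monotone fun t ↦ (α t).1 :=
    monotone_of_hasDerivAt_nonneg hu fun t ↦ by simp only [Pi.zero_apply]; positivity
  refine ⟨fun t ↦ (α t).1, fun t ↦ (α t).2, by simp [hα0], by simp [hα0], fun t ht ↦ ?_⟩
  have hat : a ≤ (α t).1 := by simpa [hα0] using hmono ht
  exact ⟨hat, hu t, by simpa [max_eq_left hat] using hθ t⟩

/-- Along a solution in polar variables, `u = 1 / H` grows without bound: a suitable multiple of
`u` minus the bounded quantity `sin θ cos θ` grows at least linearly. -/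
theorem tendsto_atTop_of_polar_solution {m a : ℝ} (hm : 0 < m) (ha : 0 < a) {u θ : ℝ → ℝ}
    (h : ∀ t, 0 ≤ t → a ≤ u t ∧ HasDerivAt u (3 * cos (θ t) ^ 2) t ∧
      HasDerivAt θ (m + 3 * (sin (θ t) * cos (θ t)) / u t) t) :
    Tendsto u atTop atTop := by
  set C : ℝ := 9 / (2 * m * a ^ 2) + 2 * m + 3 / a with hC
  have hCpos : 0 < C := by positivity
  set g : ℝ → ℝ := fun t ↦ C / 3 * u t - sin (θ t) * cos (θ t) - m / 2 * t
  have hderiv (t : ℝ) (ht : 0 ≤ t) : HasDerivAt g (C / 3 * (3 * cos (θ t) ^ 2)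
      - (cos (θ t) * (m + 3 * (sin (θ t) * cos (θ t)) / u t) * cos (θ t)
        + sin (θ t) * (-sin (θ t) * (m + 3 * (sin (θ t) * cos (θ t)) / u t))) - m / 2 * 1) t := by
    obtain ⟨-, hu, hθ⟩ := h t ht
    exact ((hu.const_mul _).sub (hθ.sin.mul hθ.cos)).sub ((hasDerivAt_id t).const_mul _)
  have hmono : MonotoneOn g (Ici 0) := by
    refine monotoneOn_of_deriv_nonneg (convex_Ici 0)
      (HasDerivAt.continuousOn fun t ht ↦ hderiv t ht)
      (fun t ht ↦ (hderiv t (interior_subset ht)).differentiableAt.differentiableWithinAt)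
      fun t ht ↦ ?_
    have ht0 : 0 ≤ t := interior_subset ht
    rw [(hderiv t ht0).deriv]
    have hau := (h t ht0).1
    have hsc := sin_sq_add_cos_sq (θ t)
    set s := sin (θ t)
    set c := cos (θ t)
    have hupos := ha.trans_le hau
    have e1 : 3 * (s * c) / u t = c * (3 * s / u t) := by ring
    have hw : |3 * s / u t| ≤ 3 / a := by
      rw [abs_div, abs_of_pos hupos, abs_mul, abs_of_pos (by norm_num : (0 : ℝ) < 3)]
      have : |s| ≤ 1 := abs_sin_le_one _
      gcongr
      linarith
    rw [e1]
    set w := 3 * s / u t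
    have hw2 : w ^ 2 ≤ (3 / a) ^ 2 := sq_le_sq' (abs_le.1 hw).1 (abs_le.1 hw).2
    have hs2 : s ^ 2 = 1 - c ^ 2 := by linarith
    have hquad : 0 ≤ m / 2 + c * w + 9 / (2 * m * a ^ 2) * c ^ 2 := by
      have : 9 / (2 * m * a ^ 2) * c ^ 2 = (3 / a) ^ 2 * c ^ 2 / (2 * m) := by
        field_simp; ring
      rw [this]
      have h1 : w ^ 2 * c ^ 2 / (2 * m) ≤ (3 / a) ^ 2 * c ^ 2 / (2 * m) := by gcongr
      have h2 : m / 2 + c * w + w ^ 2 * c ^ 2 / (2 * m) = (m + c * w) ^ 2 / (2 * m) := by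
        field_simp; ring
      have h3 : 0 ≤ (m + c * w) ^ 2 / (2 * m) := by positivity
      linarith
    have hcube : 2 * c ^ 2 * (c * w) ≤ 3 / a * c ^ 2 := by
      have hsc' : |2 * (c * s)| ≤ 1 := by
        rw [abs_le]
        constructor <;> nlinarith [sq_nonneg (s + c), sq_nonneg (s - c)]
      have : 2 * (c * w) ≤ 3 / a := by
        have e : 2 * (c * w) = 3 * (2 * (c * s)) / u t := by simp only [w]; ring
        rw [e]
        have := (abs_le.1 hsc').2
        calc 3 * (2 * (c * s)) / u t ≤ 3 / u t := by gcongr; linarith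
          _ ≤ 3 / a := by gcongr
      nlinarith [mul_le_mul_of_nonneg_right this (sq_nonneg c)]
    have : C / 3 * (3 * c ^ 2) - (c * (m + c * w) * c + s * (-s * (m + c * w))) - m / 2 * 1
        = (m / 2 + c * w + 9 / (2 * m * a ^ 2) * c ^ 2)
          + (3 / a * c ^ 2 - 2 * c ^ 2 * (c * w)) := by
      have : s * (-s * (m + c * w)) = -(1 - c ^ 2) * (m + c * w) := by rw [← hs2]; ring
      rw [this, hC]; ring
    linarith
  have hlin : Tendsto (fun t : ℝ ↦ 3 / C * (m / 2 * t + (g 0 - 1))) atTop atTop :=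
    ((tendsto_id.const_mul_atTop (by positivity)).atTop_add tendsto_const_nhds).const_mul_atTop
      (by positivity)
  refine tendsto_atTop_mono' _ ?_ hlin
  filter_upwards [eventually_ge_atTop 0] with t ht
  have hge : g 0 ≤ g t := hmono self_mem_Ici ht ht
  have hsc : -1 ≤ sin (θ t) * cos (θ t) := by
    nlinarith [sin_sq_add_cos_sq (θ t), sq_nonneg (sin (θ t) + cos (θ t))]
  have hgt : g t = C / 3 * u t - sin (θ t) * cos (θ t) - m / 2 * t := rfl
  calc 3 / C * (m / 2 * t + (g 0 - 1)) ≤ 3 / C * (C / 3 * u t) := by gcongr; linarith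
    _ = u t := by field_simp

theorem exists_eq_cos_eq_sin {x y : ℝ} (h : x ^ 2 + y ^ 2 = 1) : ∃ θ, x = cos θ ∧ y = sin θ := by
  have hn : ‖(⟨x, y⟩ : ℂ)‖ = 1 := by
    rw [Complex.norm_def, Complex.normSq_mk, ← sq, ← sq, h, sqrt_one]
  have h0 : (⟨x, y⟩ : ℂ) ≠ 0 := norm_ne_zero_iff.1 (by rw [hn]; exact one_ne_zero)
  exact ⟨Complex.arg ⟨x, y⟩, by simp [Complex.cos_arg h0, hn], by simp [Complex.sin_arg, hn]⟩

/-- Any C² solution of the flat FLRW scalar field equations with quadratic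
potential on a forward interval [0, b) with H(0) > 0 extends to a solution defined for all
t ≥ 0 (the maximal forward interval of existence is [0, ∞)), along which
H(t) → 0, φ(t) → 0 and φ̇(t) → 0 as t → +∞. -/
theorem stmt_18 (m : ℝ) (hm : 0 < m) (b : ℝ) (hb : 0 < b)
    (H φ H' φ' φ'' : ℝ → ℝ)
    (hH : ∀ t ∈ Set.Ico (0:ℝ) b, HasDerivAt H (H' t) t)
    (hφ : ∀ t ∈ Set.Ico (0:ℝ) b, HasDerivAt φ (φ' t) t)
    (hφ' : ∀ t ∈ Set.Ico (0:ℝ) b, HasDerivAt φ' (φ'' t) t)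
    (hFried : ∀ t ∈ Set.Ico (0:ℝ) b,
      3 * (H t)^2 = (1/2) * (φ' t)^2 + (1/2) * m^2 * (φ t)^2)
    (hRay : ∀ t ∈ Set.Ico (0:ℝ) b, H' t = -(1/2) * (φ' t)^2)
    (hKG : ∀ t ∈ Set.Ico (0:ℝ) b, φ'' t + 3 * H t * φ' t + m^2 * φ t = 0)
    (hH0 : 0 < H 0) :
    ∃ H₁ φ₁ H₁' φ₁' φ₁'' : ℝ → ℝ,
      (∀ t ∈ Set.Ico (0:ℝ) b, H₁ t = H t ∧ φ₁ t = φ t) ∧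
      (∀ t ∈ Set.Ici (0:ℝ),
        HasDerivAt H₁ (H₁' t) t ∧ HasDerivAt φ₁ (φ₁' t) t ∧
        HasDerivAt φ₁' (φ₁'' t) t ∧
        3 * (H₁ t)^2 = (1/2) * (φ₁' t)^2 + (1/2) * m^2 * (φ₁ t)^2 ∧
        H₁' t = -(1/2) * (φ₁' t)^2 ∧
        φ₁'' t + 3 * H₁ t * φ₁' t + m^2 * φ₁ t = 0) ∧
      Tendsto H₁ atTop (nhds 0) ∧
      Tendsto φ₁ atTop (nhds 0) ∧
      Tendsto φ₁' atTop (nhds 0) := by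
  have h6 : √6 ^ 2 = 6 := sq_sqrt (by norm_num)
  obtain ⟨θ₀, hcos, hsin⟩ : ∃ θ, φ' 0 / (√6 * H 0) = cos θ ∧ m * φ 0 / (√6 * H 0) = sin θ := by
    refine exists_eq_cos_eq_sin ?_
    rw [div_pow, div_pow, mul_pow, h6, ← add_div, div_eq_one_iff_eq (by positivity)]
    linarith [hFried 0 ⟨le_rfl, hb⟩]
  have ha : 0 < (H 0)⁻¹ := inv_pos.2 hH0
  obtain ⟨u, θ, hu0, hθ0, hsol⟩ := exists_polar_solution m ha θ₀
  have hutop := tendsto_atTop_of_polar_solution hm ha hsol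
  have hH₁ (t : ℝ) (ht : 0 ≤ t) :
      HasDerivAt (fun t ↦ (u t)⁻¹) (-(1/2) * (√6 * (u t)⁻¹ * cos (θ t)) ^ 2) t := by
    obtain ⟨hat, hu, -⟩ := hsol t ht
    have hne : u t ≠ 0 := (ha.trans_le hat).ne'
    refine (hu.inv hne).congr_deriv ?_
    rw [mul_pow, mul_pow, h6]
    field_simp; ring
  have hφ₁ (t : ℝ) (ht : 0 ≤ t) :
      HasDerivAt (fun t ↦ √6 / m * ((u t)⁻¹ * sin (θ t))) (√6 * (u t)⁻¹ * cos (θ t)) t := by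
    obtain ⟨hat, -, hθ⟩ := hsol t ht
    have hne : u t ≠ 0 := (ha.trans_le hat).ne'
    refine (((hH₁ t ht).mul hθ.sin).const_mul (√6 / m)).congr_deriv ?_
    rw [mul_pow, mul_pow, h6]
    field_simp; ring
  have hψ₁ (t : ℝ) (ht : 0 ≤ t) :
      HasDerivAt (fun t ↦ √6 * (u t)⁻¹ * cos (θ t))
        (-3 * (u t)⁻¹ * (√6 * (u t)⁻¹ * cos (θ t)) - m ^ 2 * (√6 / m * ((u t)⁻¹ * sin (θ t)))) t := by
    obtain ⟨hat, -, hθ⟩ := hsol t ht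
    have hne : u t ≠ 0 := (ha.trans_le hat).ne'
    refine (((hH₁ t ht).const_mul √6).mul hθ.cos).congr_deriv ?_
    rw [mul_pow, mul_pow, h6]
    field_simp
    linear_combination (-6 * cos (θ t)) * sin_sq_add_cos_sq (θ t)
  have heq : EqOn (fun t ↦ ((u t)⁻¹, √6 / m * ((u t)⁻¹ * sin (θ t)), √6 * (u t)⁻¹ * cos (θ t)))
      (fun t ↦ (H t, φ t, φ' t)) (Ico 0 b) := by
    have hv : ContDiff ℝ 1 fun p : ℝ × ℝ × ℝ ↦
        (-(1/2) * p.2.2 ^ 2, p.2.2, -3 * p.1 * p.2.2 - m ^ 2 * p.2.1) := by fun_prop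
    refine hv.locallyLipschitz.eqOn_Ico_of_hasDerivAt
      (fun t ht ↦ (hH₁ t ht.1).prodMk ((hφ₁ t ht.1).prodMk (hψ₁ t ht.1))) (fun t ht ↦ ?_) ?_
    · have e : φ'' t = -3 * H t * φ' t - m ^ 2 * φ t := by linarith [hKG t ht]
      exact (hRay t ht ▸ hH t ht).prodMk ((hφ t ht).prodMk (e ▸ hφ' t ht))
    · simp only [hu0, hθ0, inv_inv, ← hcos, ← hsin, Prod.mk.injEq]
      refine ⟨trivial, ?_, ?_⟩ <;> field_simp
  have hH₁lim : Tendsto (fun t ↦ (u t)⁻¹) atTop (nhds 0) := tendsto_inv_atTop_zero.comp hutop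
  refine ⟨fun t ↦ (u t)⁻¹, fun t ↦ √6 / m * ((u t)⁻¹ * sin (θ t)), _,
    fun t ↦ √6 * (u t)⁻¹ * cos (θ t), _, fun t ht ↦ ?_,
    fun t ht ↦ ⟨hH₁ t ht, hφ₁ t ht, hψ₁ t ht, ?_, rfl, by ring⟩, hH₁lim, ?_, ?_⟩
  · have := heq ht
    simp only [Prod.mk.injEq] at this
    exact ⟨this.1, this.2.1⟩
  · simp only [mul_pow, div_pow, h6]
    field_simp
    linear_combination (-6 * (u t)⁻¹ ^ 2) * sin_sq_add_cos_sq (θ t)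
  · have := (hH₁lim.zero_mul_isBoundedUnder_le (g := fun t ↦ sin (θ t))
      (isBoundedUnder_of ⟨1, fun t ↦ abs_sin_le_one _⟩)).const_mul (√6 / m)
    simpa using this
  · have := (hH₁lim.zero_mul_isBoundedUnder_le (g := fun t ↦ cos (θ t))
      (isBoundedUnder_of ⟨1, fun t ↦ abs_cos_le_one _⟩)).const_mul √6
    simpa [mul_assoc] using this
end
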